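/- Let s ≥ 2 and m be natural numbers and let A be a non-empty subset of S_{3,m}. Writing η_s = 2^{−1} · 3^{−s+2}, for every ε > 0 there is a constant C(s, ε) > 0, independent of m and A, such that E_{s,2}(A) ≤ C(s, ε) · m^ε · |A|^{2s − 3 + 1/2 + η_s}. -/

import Mathlib

open Finset

noncomputable section

/-- The set of lattice points on the sphere of radius `√m` in `ℤ^d`. -/
def latSphere (d m : ℕ) : Set (Fin d → ℤ) := {x | ∑ i, x i ^ 2 = (m : ℤ)}

/-- The additive energy `E_{s,2}(A)`: the number of `2s`-tuples
`(x₁, …, x_{2s}) ∈ A^{2s}` with `x₁ + ⋯ + x_s = x_{s+1} + ⋯ + x_{2s}`. -/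
def addEnergy {V : Type*} [AddCommMonoid V] (s : ℕ) (A : Set V) : ℕ :=
  Nat.card {p : (Fin s → V) × (Fin s → V) //
    (∀ i, p.1 i ∈ A) ∧ (∀ i, p.2 i ∈ A) ∧ ∑ i, p.1 i = ∑ i, p.2 i}

/-- The representation function `r_s(A, n)`: the number of `s`-tuples
`(x₁, …, x_s) ∈ A^s` with `x₁ + ⋯ + x_s = n`. -/
def repCount {V : Type*} [AddCommMonoid V] (s : ℕ) (A : Set V) (n : V) : ℕ :=
  Nat.card {x : Fin s → V // (∀ i, x i ∈ A) ∧ ∑ i, x i = n}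

theorem divisor_bound (ε : ℝ) (hε : 0 < ε) :
    ∃ C : ℝ, 1 ≤ C ∧ ∀ n : ℕ, 0 < n → ((n.divisors.card : ℕ) : ℝ) ≤ C * (n : ℝ) ^ ε := by
  have hl2 : 0 < Real.log 2 := Real.log_pos (by norm_num)
  set C0 : ℝ := 1 + 1 / (ε * Real.log 2) with hC0
  have hC0' : 1 ≤ C0 := by
    have : 0 ≤ 1 / (ε * Real.log 2) := by positivity
    linarith
  obtain ⟨B, hB⟩ := exists_nat_gt ((2:ℝ) ^ (1 / ε))
  refine ⟨C0 ^ B, one_le_pow₀ hC0', fun n hn => ?_⟩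
  have hfac : ((n.divisors.card : ℕ) : ℝ) = ∏ p ∈ n.primeFactors, ((n.factorization p : ℝ) + 1) := by
    rw [Nat.card_divisors hn.ne']
    push_cast
    rfl
  have hn' : (n : ℝ) ^ ε = ∏ p ∈ n.primeFactors, ((p : ℝ) ^ (n.factorization p)) ^ ε := by
    rw [Real.finsetProd_rpow]
    · congr 1
      conv_lhs => rw [← Nat.prod_factorization_pow_eq_self hn.ne']
      rw [Finsupp.prod]
      push_cast
      rfl
    · intros; positivity
  have key : ∀ p ∈ n.primeFactors, ((n.factorization p : ℝ) + 1) ≤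
      (if p < B then C0 else 1) * ((p : ℝ) ^ (n.factorization p)) ^ ε := by
    intro p hp
    have hp2 : 2 ≤ p := (Nat.prime_of_mem_primeFactors hp).two_le
    have hp2' : (2:ℝ) ≤ p := by exact_mod_cast hp2
    set v := n.factorization p
    have e1 : ((p : ℝ) ^ v) ^ ε = ((p:ℝ) ^ ε) ^ v := by
      rw [← Real.rpow_natCast, ← Real.rpow_natCast, ← Real.rpow_mul (by positivity),
        ← Real.rpow_mul (by positivity), mul_comm]
    rw [e1]
    split_ifs with h
    · have h1 : (2:ℝ) ^ ε ≤ (p:ℝ) ^ ε := Real.rpow_le_rpow (by norm_num) hp2' hε.le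
      have h2 : ((2:ℝ) ^ ε) ^ v ≤ ((p:ℝ) ^ ε) ^ v := by gcongr
      have h3 : 1 + v * (ε * Real.log 2) ≤ ((2:ℝ) ^ ε) ^ v := by
        have : ((2:ℝ) ^ ε) ^ v = Real.exp (v * (ε * Real.log 2)) := by
          rw [Real.rpow_def_of_pos (by norm_num), ← Real.exp_nat_mul]; ring_nf
        rw [this]
        linarith [Real.add_one_le_exp (v * (ε * Real.log 2))]
      have h4 : (v:ℝ) + 1 ≤ C0 * (1 + v * (ε * Real.log 2)) := by
        have : C0 * (1 + v * (ε * Real.log 2)) = 1 + 1 / (ε * Real.log 2) + v * (ε * Real.log 2) + v := by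
          rw [hC0]; field_simp; ring
        rw [this]
        have : 0 ≤ 1 / (ε * Real.log 2) := by positivity
        have : 0 ≤ v * (ε * Real.log 2) := by positivity
        linarith
      calc (v:ℝ) + 1 ≤ C0 * (1 + v * (ε * Real.log 2)) := h4
        _ ≤ C0 * ((p:ℝ) ^ ε) ^ v := by gcongr; linarith
    · have h1 : (2:ℝ) ≤ (p:ℝ) ^ ε := by
        have hBp : (B:ℝ) ≤ p := by exact_mod_cast not_lt.mp h
        have : ((2:ℝ) ^ (1/ε)) ^ ε ≤ (p:ℝ) ^ ε :=
          Real.rpow_le_rpow (by positivity) (by linarith) hε.le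
        rwa [← Real.rpow_mul (by norm_num), one_div, inv_mul_cancel₀ hε.ne', Real.rpow_one] at this
      have h2 : (2:ℝ) ^ v ≤ ((p:ℝ) ^ ε) ^ v := by gcongr
      have h3 : (v:ℝ) + 1 ≤ 2 ^ v := by exact_mod_cast (Nat.lt_two_pow_self (n := v))
      linarith
  rw [hfac, hn']
  calc _ ≤ ∏ p ∈ n.primeFactors, (if p < B then C0 else 1) * ((p : ℝ) ^ (n.factorization p)) ^ ε :=
        Finset.prod_le_prod (fun _ _ => by positivity) key
    _ = (∏ p ∈ n.primeFactors, (if p < B then C0 else 1)) * _ := Finset.prod_mul_distrib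
    _ ≤ _ := by
      gcongr
      rw [Finset.prod_ite]
      simp only [prod_const, one_pow, mul_one]
      apply pow_le_pow_right₀ hC0'
      calc _ ≤ (range B).card := Finset.card_le_card (by intro x; simp)
        _ = B := card_range B

theorem prim_aux (Δ M : ℕ) (hM : 0 < M)
    (hsq : ∀ p : ℕ, p.Prime → p ^ 2 ∣ Δ → p ^ 2 ∣ M → False)
    (X0 Y0 X Y X' Y' : ℤ) (h0 : X0 ^ 2 + Δ * Y0 ^ 2 = M) (h : X ^ 2 + Δ * Y ^ 2 = M)
    (h' : X' ^ 2 + Δ * Y' ^ 2 = M) (c0 : IsCoprime X0 Y0) (c : IsCoprime X Y)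
    (hg : Int.gcd (X * Y0 - X0 * Y) M = Int.gcd (X' * Y0 - X0 * Y') M) :
    (M : ℤ) ∣ 2 * (X * Y' - X' * Y) := by
  have cY0 : IsCoprime Y0 (M:ℤ) := by
    rw [← h0]
    have : IsCoprime Y0 (X0 ^ 2) := c0.symm.pow_right
    have h2 : X0 ^ 2 + Δ * Y0 ^ 2 = X0 ^ 2 + Y0 * (Δ * Y0) := by ring
    rw [h2]
    exact this.add_mul_left_right _
  set g : ℕ := Int.gcd (X * Y0 - X0 * Y) M with hgdef
  have hgM : g ∣ M := by
    have := Int.gcd_dvd_right (X * Y0 - X0 * Y) (M:ℤ)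
    exact_mod_cast this
  have hgpos : 0 < g := Nat.pos_of_dvd_of_pos hgM hM
  obtain ⟨f, hf⟩ := hgM
  have hfpos : 0 < f := by
    rcases Nat.eq_zero_or_pos f with h | h
    · subst h; omega
    · exact h
  have hg1 : (g:ℤ) ∣ X * Y0 - X0 * Y := Int.gcd_dvd_left _ _
  have hg2 : (g:ℤ) ∣ X' * Y0 - X0 * Y' := by rw [hg]; exact Int.gcd_dvd_left _ _
  have hfd : ∀ X Y : ℤ, X ^ 2 + Δ * Y ^ 2 = M → Int.gcd (X * Y0 - X0 * Y) M = g →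
      (f:ℤ) ∣ X * Y0 + X0 * Y := by
    intro X Y h hg
    have hd : (M:ℤ) ∣ (X * Y0 - X0 * Y) * (X * Y0 + X0 * Y) := by
      refine ⟨Y0 ^ 2 - Y ^ 2, ?_⟩
      linear_combination Y0^2 * h - Y^2 * h0
    obtain ⟨a, b, hab⟩ : ∃ a b : ℤ, (g:ℤ) = (X * Y0 - X0 * Y) * a + M * b :=
      ⟨_, _, by rw [← hg]; exact Int.gcd_eq_gcd_ab _ _⟩
    have h3 : (M:ℤ) ∣ g * (X * Y0 + X0 * Y) := by
      rw [hab]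
      obtain ⟨k, hk⟩ := hd
      refine ⟨k * a + b * (X * Y0 + X0 * Y), ?_⟩
      linear_combination a * hk
    rw [hf] at h3
    push_cast at h3
    exact (mul_dvd_mul_iff_left (by exact_mod_cast hgpos.ne')).mp h3
  have hf1 := hfd X Y h rfl
  have hf2 := hfd X' Y' h' hg.symm
  have cg : IsCoprime (g:ℤ) Y0 :=
    (cY0.symm).of_isCoprime_of_dvd_left (by rw [hf]; push_cast; exact dvd_mul_right _ _)
  have cf : IsCoprime (f:ℤ) Y0 :=
    (cY0.symm).of_isCoprime_of_dvd_left (by rw [hf]; push_cast; exact dvd_mul_left _ _)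
  have hgw : (g:ℤ) ∣ X * Y' - X' * Y := by
    refine cg.dvd_of_dvd_mul_left ?_
    have : Y0 * (X * Y' - X' * Y) = Y' * (X * Y0 - X0 * Y) - Y * (X' * Y0 - X0 * Y') := by ring
    rw [this]
    exact dvd_sub (hg1.mul_left _) (hg2.mul_left _)
  have hfw : (f:ℤ) ∣ X * Y' - X' * Y := by
    refine cf.dvd_of_dvd_mul_left ?_
    have : Y0 * (X * Y' - X' * Y) = Y' * (X * Y0 + X0 * Y) - Y * (X' * Y0 + X0 * Y') := by ring
    rw [this]
    exact dvd_sub (hf1.mul_left _) (hf2.mul_left _)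
  set e := Nat.gcd g f with he
  have he2 : e ∣ 2 := by
    by_contra hne
    have hepos : 0 < e := Nat.gcd_pos_of_pos_left _ hgpos
    obtain ⟨q, hq⟩ : Nat.gcd e 2 ∣ e := Nat.gcd_dvd_left _ _
    have hq1 : q ≠ 1 := by
      rintro rfl
      rw [mul_one] at hq
      exact hne (hq ▸ Nat.gcd_dvd_right _ _)
    obtain ⟨p, hp, hpq⟩ := Nat.exists_prime_and_dvd hq1
    have hpe : p ∣ e := hpq.trans ⟨_, by rw [mul_comm]; exact hq⟩
    have heX : (e:ℤ) ∣ 2 * X := by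
      have e1 : (e:ℤ) ∣ X * Y0 - X0 * Y := (Int.natCast_dvd_natCast.mpr (Nat.gcd_dvd_left g f)).trans hg1
      have e2 : (e:ℤ) ∣ X * Y0 + X0 * Y := (Int.natCast_dvd_natCast.mpr (Nat.gcd_dvd_right g f)).trans hf1
      have e3 : (e:ℤ) ∣ Y0 * (2 * X) := by
        have : Y0 * (2 * X) = (X * Y0 - X0 * Y) + (X * Y0 + X0 * Y) := by ring
        rw [this]; exact dvd_add e1 e2
      exact (cg.of_isCoprime_of_dvd_left (Int.natCast_dvd_natCast.mpr (Nat.gcd_dvd_left g f))).dvd_of_dvd_mul_left e3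
    have hpX : (p:ℤ) ∣ X := by
      have h1 : e ∣ 2 * X.natAbs := by
        have := Int.natAbs_dvd_natAbs.mpr heX
        simpa [Int.natAbs_mul] using this
      have h2 : q ∣ X.natAbs := by
        have hcop : Nat.Coprime q (2 / Nat.gcd e 2) := by
          have := Nat.coprime_div_gcd_div_gcd (m := e) (n := 2) (Nat.gcd_pos_of_pos_left _ hepos)
          have hq' : e / Nat.gcd e 2 = q := Nat.div_eq_of_eq_mul_right (Nat.gcd_pos_of_pos_left _ hepos) hq
          rwa [hq'] at this
        obtain ⟨r, hr⟩ : Nat.gcd e 2 ∣ 2 := Nat.gcd_dvd_right _ _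
        have hr' : 2 / Nat.gcd e 2 = r := Nat.div_eq_of_eq_mul_right (Nat.gcd_pos_of_pos_left _ hepos) hr
        rw [hr'] at hcop
        apply hcop.dvd_of_dvd_mul_left
        have : Nat.gcd e 2 * q ∣ Nat.gcd e 2 * (r * X.natAbs) := by
          rw [← hq, ← mul_assoc, ← hr]; exact h1
        exact (mul_dvd_mul_iff_left (Nat.gcd_pos_of_pos_left _ hepos).ne').mp this
      exact Int.natCast_dvd.mpr (hpq.trans h2)
    have hpM : p ^ 2 ∣ M := by
      rw [hf, sq]
      exact mul_dvd_mul (hpe.trans (Nat.gcd_dvd_left _ _)) (hpe.trans (Nat.gcd_dvd_right _ _))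
    have hpY : IsCoprime ((p:ℤ)^2) (Y^2) := (c.of_isCoprime_of_dvd_left hpX).pow
    have hpD : p ^ 2 ∣ Δ := by
      have h1 : ((p:ℤ)^2) ∣ Δ * Y ^ 2 := by
        have : (Δ:ℤ) * Y ^ 2 = M - X ^ 2 := by linarith
        rw [this]
        exact dvd_sub (by exact_mod_cast hpM) (pow_dvd_pow_of_dvd hpX 2)
      have := hpY.dvd_of_dvd_mul_right h1
      exact_mod_cast this
    exact hsq p hp hpD hpM
  -- M ∣ e * lcm
  have hlcm : ((Nat.lcm g f : ℕ):ℤ) ∣ X * Y' - X' * Y := by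
    rw [Int.natCast_dvd]
    exact Nat.lcm_dvd (Int.natCast_dvd.mp hgw) (Int.natCast_dvd.mp hfw)
  have : (M:ℤ) = e * (Nat.lcm g f : ℕ) := by
    rw [hf, ← Nat.gcd_mul_lcm g f]; push_cast; rfl
  rw [this]
  exact mul_dvd_mul (by exact_mod_cast he2) hlcm

theorem prim_fiber (Δ M : ℕ) (hΔ : 0 < Δ) (hM : 0 < M) (X Y : ℤ) (h : X ^ 2 + Δ * Y ^ 2 = M)
    (T : Finset (ℤ × ℤ)) (hT : ∀ x ∈ T, x.1 ^ 2 + Δ * x.2 ^ 2 = (M:ℤ) ∧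
      (M : ℤ) ∣ 2 * (X * x.2 - x.1 * Y)) : T.card ≤ 10 := by
  classical
  have hM' : (0:ℤ) < M := by exact_mod_cast hM
  have hΔ' : (1:ℤ) ≤ Δ := by exact_mod_cast hΔ
  have : T.card ≤ ((Finset.Icc (-2:ℤ) 2) ×ˢ (Finset.univ : Finset Bool)).card := by
    apply Finset.card_le_card_of_injOn
      (fun x => (2 * (X * x.2 - x.1 * Y) / (M:ℤ), decide (0 ≤ X * x.1 + Δ * Y * x.2)))
    · intro x hx
      obtain ⟨h1, k, hk⟩ := hT x hx
      simp only [coe_product, coe_Icc, coe_univ, Set.mem_prod, Set.mem_Icc, Set.mem_univ, and_true]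
      rw [hk, Int.mul_ediv_cancel_left _ hM'.ne']
      have h2 : 4 * (X * x.1 + Δ * Y * x.2) ^ 2 + Δ * (M * k) ^ 2 = 4 * (M:ℤ) ^ 2 := by
        rw [← hk]
        linear_combination (4 * x.1 ^ 2 + 4 * Δ * x.2 ^ 2) * h + 4 * (M:ℤ) * h1
      have h3 : (M:ℤ)^2 * (k^2) ≤ (M:ℤ)^2 * 4 := by
        have : 0 ≤ ((Δ:ℤ) - 1) * (M * k)^2 := mul_nonneg (by linarith) (sq_nonneg _)
        nlinarith [sq_nonneg (X * x.1 + Δ * Y * x.2)]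
      have h4 : k^2 ≤ 4 := le_of_mul_le_mul_left h3 (by positivity)
      constructor <;> nlinarith
    · intro x hx y hy hxy
      simp only [Prod.mk.injEq] at hxy
      obtain ⟨h1, k, hk⟩ := hT x hx
      obtain ⟨h1', k', hk'⟩ := hT y hy
      obtain ⟨e1, e2⟩ := hxy
      rw [hk, hk', Int.mul_ediv_cancel_left _ hM'.ne', Int.mul_ediv_cancel_left _ hM'.ne'] at e1
      subst e1
      have hw : X * x.2 - x.1 * Y = X * y.2 - y.1 * Y := by linarith
      have hv2 : (X * x.1 + Δ * Y * x.2) ^ 2 = (X * y.1 + Δ * Y * y.2) ^ 2 := by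
        have a1 : (X * x.1 + Δ * Y * x.2) ^ 2 + Δ * (X * x.2 - x.1 * Y) ^ 2 = (M:ℤ) ^ 2 := by
          linear_combination (x.1 ^ 2 + Δ * x.2 ^ 2) * h + (M:ℤ) * h1
        have a2 : (X * y.1 + Δ * Y * y.2) ^ 2 + Δ * (X * y.2 - y.1 * Y) ^ 2 = (M:ℤ) ^ 2 := by
          linear_combination (y.1 ^ 2 + Δ * y.2 ^ 2) * h + (M:ℤ) * h1'
        rw [hw] at a1
        linarith
      have hv : X * x.1 + Δ * Y * x.2 = X * y.1 + Δ * Y * y.2 := by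
        rcases sq_eq_sq_iff_eq_or_eq_neg.mp hv2 with h | h
        · exact h
        · have := decide_eq_decide.mp e2
          by_cases hc : 0 ≤ X * x.1 + Δ * Y * x.2
          · have := this.mp hc; linarith
          · have h5 := (not_congr this).mp hc; linarith
      have hx1 : (M:ℤ) * x.1 = M * y.1 := by
        linear_combination X * hv - Δ * Y * hw + (y.1 - x.1) * h
      have hx2 : (M:ℤ) * x.2 = M * y.2 := by
        linear_combination Y * hv + X * hw + (y.2 - x.2) * h
      exact Prod.ext (mul_left_cancel₀ hM'.ne' hx1) (mul_left_cancel₀ hM'.ne' hx2)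
  simpa using this

theorem prim_count0 (Δ M : ℕ) (hΔ : 0 < Δ) (hM : 0 < M)
    (hsq : ∀ p : ℕ, p.Prime → p ^ 2 ∣ Δ → p ^ 2 ∣ M → False)
    (S : Finset (ℤ × ℤ)) (hS : ∀ x ∈ S, x.1 ^ 2 + Δ * x.2 ^ 2 = (M:ℤ) ∧ IsCoprime x.1 x.2) :
    S.card ≤ 10 * M.divisors.card := by
  classical
  rcases S.eq_empty_or_nonempty with rfl | ⟨x0, hx0⟩
  · simp
  apply Finset.card_le_mul_card_image_of_maps_to
    (f := fun x : ℤ × ℤ => Int.gcd (x.1 * x0.2 - x0.1 * x.2) M)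
  · intro x _
    rw [Nat.mem_divisors]
    refine ⟨?_, hM.ne'⟩
    have := Int.gcd_dvd_right (x.1 * x0.2 - x0.1 * x.2) (M:ℤ)
    exact_mod_cast this
  · intro g _
    rcases (S.filter fun x => Int.gcd (x.1 * x0.2 - x0.1 * x.2) M = g).eq_empty_or_nonempty with h | ⟨y, hy⟩
    · rw [h]; simp
    · rw [mem_filter] at hy
      apply prim_fiber Δ M hΔ hM y.1 y.2 (hS y hy.1).1
      intro x hx
      rw [mem_filter] at hx
      exact ⟨(hS x hx.1).1, prim_aux Δ M hM hsq x0.1 x0.2 y.1 y.2 x.1 x.2 (hS x0 hx0).1 (hS y hy.1).1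
        (hS x hx.1).1 (hS x0 hx0).2 (hS y hy.1).2 (hy.2.trans hx.2.symm)⟩

theorem card_div_mono {a b : ℕ} (hb : 0 < b) (h : a ∣ b) : a.divisors.card ≤ b.divisors.card :=
  Finset.card_le_card (Nat.divisors_subset_of_dvd hb.ne' h)

theorem prim_count (M : ℕ) : ∀ (Δ : ℕ) (_ : 0 < Δ) (_ : 0 < M)
    (S : Finset (ℤ × ℤ)) (_ : ∀ x ∈ S, x.1 ^ 2 + Δ * x.2 ^ 2 = (M:ℤ) ∧ IsCoprime x.1 x.2),
    S.card ≤ 10 * M.divisors.card := by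
  classical
  induction M using Nat.strong_induction_on with
  | _ M ih =>
    intro Δ hΔ hM S hS
    by_cases hsq : ∀ p : ℕ, p.Prime → p ^ 2 ∣ Δ → p ^ 2 ∣ M → False
    · exact prim_count0 Δ M hΔ hM hsq S hS
    · push Not at hsq
      obtain ⟨p, hp, ⟨D', hD'⟩, ⟨M', hM'⟩, -⟩ := hsq
      have hp0 : (p:ℤ) ≠ 0 := by exact_mod_cast hp.ne_zero
      have hpX : ∀ x ∈ S, (p:ℤ) ∣ x.1 := by
        intro x hx
        have h1 := (hS x hx).1
        have : (p:ℤ)^2 ∣ x.1 ^ 2 := by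
          refine ⟨M' - D' * x.2 ^ 2, ?_⟩
          rw [hD', hM'] at h1; push_cast at h1
          linear_combination h1
        exact (Int.pow_dvd_pow_iff (by norm_num)).mp this
      have hM'pos : 0 < M' := by
        rcases Nat.eq_zero_or_pos M' with h | h
        · subst h; omega
        · exact h
      have hD'pos : 0 < D' := by
        rcases Nat.eq_zero_or_pos D' with h | h
        · subst h; omega
        · exact h
      have hlt : M' < M := by
        rw [hM']
        have : 1 < p ^ 2 := Nat.one_lt_pow (by norm_num) hp.one_lt
        nlinarith
      have hinj : Set.InjOn (fun x : ℤ × ℤ => (x.1 / (p:ℤ), x.2)) S := by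
        intro x hx y hy hxy
        simp only [Prod.mk.injEq] at hxy
        obtain ⟨a, ha⟩ := hpX x hx
        obtain ⟨b, hb⟩ := hpX y hy
        rw [ha, hb, Int.mul_ediv_cancel_left _ hp0, Int.mul_ediv_cancel_left _ hp0] at hxy
        exact Prod.ext (by rw [ha, hb, hxy.1]) hxy.2
      rw [← Finset.card_image_of_injOn hinj]
      refine (ih M' hlt D' hD'pos hM'pos _ ?_).trans (Nat.mul_le_mul_left _ (card_div_mono hM ⟨_, by rw [hM', mul_comm]⟩))
      intro y hy
      obtain ⟨x, hx, rfl⟩ := mem_image.mp hy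
      obtain ⟨a, ha⟩ := hpX x hx
      have h1 := hS x hx
      simp only
      rw [ha, Int.mul_ediv_cancel_left _ hp0]
      rw [ha] at h1
      constructor
      · have h2 := h1.1
        rw [hD', hM'] at h2; push_cast at h2
        have : (p:ℤ)^2 * (a ^ 2 + D' * x.2 ^ 2) = p ^ 2 * M' := by linear_combination h2
        exact mul_left_cancel₀ (pow_ne_zero 2 hp0) this
      · exact h1.2.of_mul_left_right

theorem quad_count (Δ M : ℕ) (hΔ : 0 < Δ) (hM : 0 < M)
    (S : Finset (ℤ × ℤ)) (hS : ∀ x ∈ S, x.1 ^ 2 + Δ * x.2 ^ 2 = (M:ℤ)) :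
    S.card ≤ 10 * M.divisors.card * M.divisors.card := by
  classical
  have hgpos : ∀ x ∈ S, 0 < Int.gcd x.1 x.2 := by
    intro x hx
    rw [Int.gcd_pos_iff]
    by_contra hc
    push Not at hc
    have := hS x hx
    rw [hc.1, hc.2] at this
    simp at this; omega
  have hg2 : ∀ x ∈ S, (Int.gcd x.1 x.2) ^ 2 ∣ M := by
    intro x hx
    have h := hS x hx
    obtain ⟨a, ha⟩ := Int.gcd_dvd_left x.1 x.2
    obtain ⟨b, hb⟩ := Int.gcd_dvd_right x.1 x.2
    have : ((Int.gcd x.1 x.2 : ℕ):ℤ)^2 ∣ M := by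
      refine ⟨a^2 + Δ * b^2, ?_⟩
      rw [← h]
      linear_combination (x.1 + ((Int.gcd x.1 x.2:ℕ):ℤ)*a)*ha + Δ*(x.2+((Int.gcd x.1 x.2:ℕ):ℤ)*b)*hb
    exact_mod_cast this
  apply Finset.card_le_mul_card_image_of_maps_to
    (f := fun x : ℤ × ℤ => Int.gcd x.1 x.2)
  · intro x hx
    rw [Nat.mem_divisors]
    exact ⟨(Dvd.intro_left _ (by rw [sq])).trans (hg2 x hx), hM.ne'⟩
  · intro g _
    rcases (S.filter fun x => Int.gcd x.1 x.2 = g).eq_empty_or_nonempty with h | ⟨y, hy⟩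
    · rw [h]; simp
    rw [mem_filter] at hy
    obtain ⟨M', hM'⟩ := hg2 y hy.1
    have hg0 : 0 < g := hy.2 ▸ hgpos y hy.1
    rw [hy.2] at hM'
    have hg0' : (g:ℤ) ≠ 0 := by exact_mod_cast hg0.ne'
    have hM'pos : 0 < M' := by
      rcases Nat.eq_zero_or_pos M' with h | h
      · subst h; omega
      · exact h
    have hinj : Set.InjOn (fun x : ℤ × ℤ => (x.1 / (g:ℤ), x.2 / (g:ℤ))) (S.filter fun x => Int.gcd x.1 x.2 = g) := by
      intro x hx y hy hxy
      simp only [coe_filter, Set.mem_ofPred_eq] at hx hy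
      simp only [Prod.mk.injEq] at hxy
      have hx1 : (g:ℤ) ∣ x.1 := hx.2 ▸ Int.gcd_dvd_left _ _
      have hx2 : (g:ℤ) ∣ x.2 := hx.2 ▸ Int.gcd_dvd_right _ _
      have hy1 : (g:ℤ) ∣ y.1 := hy.2 ▸ Int.gcd_dvd_left _ _
      have hy2 : (g:ℤ) ∣ y.2 := hy.2 ▸ Int.gcd_dvd_right _ _
      exact Prod.ext ((Int.ediv_left_inj hx1 hy1).mp hxy.1) ((Int.ediv_left_inj hx2 hy2).mp hxy.2)
    rw [← Finset.card_image_of_injOn hinj]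
    refine (prim_count M' Δ hΔ hM'pos _ ?_).trans (Nat.mul_le_mul_left _ (card_div_mono hM ⟨_, by rw [hM', mul_comm]⟩))
    intro z hz
    obtain ⟨x, hx, rfl⟩ := mem_image.mp hz
    rw [mem_filter] at hx
    obtain ⟨a, ha⟩ : (g:ℤ) ∣ x.1 := hx.2 ▸ Int.gcd_dvd_left _ _
    obtain ⟨b, hb⟩ : (g:ℤ) ∣ x.2 := hx.2 ▸ Int.gcd_dvd_right _ _
    simp only
    have hco := hx.2
    have h1 := hS x hx.1
    rw [ha, hb] at h1 hco
    rw [ha, hb, Int.mul_ediv_cancel_left _ hg0', Int.mul_ediv_cancel_left _ hg0']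
    constructor
    · rw [hM'] at h1; push_cast at h1
      have : (g:ℤ)^2 * (a ^ 2 + Δ * b ^ 2) = g ^ 2 * M' := by linear_combination h1
      exact mul_left_cancel₀ (pow_ne_zero 2 hg0') this
    · rw [Int.isCoprime_iff_gcd_eq_one]
      rw [Int.gcd_mul_left] at hco
      have hco2 : g * Int.gcd a b = g * 1 := by simpa using hco
      exact Nat.eq_of_mul_eq_mul_left hg0 hco2

theorem circle_core (m : ℕ) (v : Fin 3 → ℤ) (i j k : Fin 3)
    (hc : ∀ l, l = i ∨ l = j ∨ l = k) (hk : v k ≠ 0) (S : Finset (Fin 3 → ℤ))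
    (hS : ∀ x ∈ S, x i ^ 2 + x j ^ 2 + x k ^ 2 = (m:ℤ) ∧
      (x i - v i) ^ 2 + (x j - v j) ^ 2 + (x k - v k) ^ 2 = (m:ℤ)) :
    S.card ≤ 1 ∨ ∃ M : ℕ, 0 < M ∧ M ≤ 64 * m ^ 3 ∧ S.card ≤ 10 * M.divisors.card * M.divisors.card := by
  classical
  have hk2 : 0 < v k ^ 2 := by positivity
  set w : ℤ := v i ^ 2 + v j ^ 2 + v k ^ 2 with hw
  set a : ℤ := v i ^ 2 + v k ^ 2 with ha
  set b : ℤ := v i * v j with hb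
  have ha0 : 0 < a := by positivity
  have hw0 : 0 < w := by positivity
  set K : ℤ := 4 * m - w with hK
  have horth : ∀ x ∈ S, (2 * x i - v i) * v i + (2 * x j - v j) * v j + (2 * x k - v k) * v k = 0 := by
    intro x hx
    obtain ⟨h1, h2⟩ := hS x hx
    linear_combination h1 - h2
  have hnorm : ∀ x ∈ S, (2 * x i - v i) ^ 2 + (2 * x j - v j) ^ 2 + (2 * x k - v k) ^ 2 = K := by
    intro x hx
    obtain ⟨h1, h2⟩ := hS x hx
    rw [hK, hw]
    linear_combination 2 * h1 + 2 * h2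
  have hquad : ∀ x ∈ S, (a * (2 * x i - v i) + b * (2 * x j - v j)) ^ 2
      + (v k ^ 2 * w) * (2 * x j - v j) ^ 2 = a * v k ^ 2 * K := by
    intro x hx
    have h1 := horth x hx
    have h2 := hnorm x hx
    rw [← h2, ha, hb, hw]
    linear_combination (v i ^ 2 + v k ^ 2) * ((2 * x i - v i) * v i + (2 * x j - v j) * v j - (2 * x k - v k) * v k) * h1
  have hinj : Set.InjOn (fun x : Fin 3 → ℤ => (a * (2 * x i - v i) + b * (2 * x j - v j), 2 * x j - v j)) S := by
    intro x hx y hy hxy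
    simp only [Prod.mk.injEq] at hxy
    obtain ⟨e1, e2⟩ := hxy
    have hj : x j = y j := by linarith
    have hi : x i = y i := by
      rw [e2] at e1
      have : a * (2 * x i - v i) = a * (2 * y i - v i) := by linarith
      have := mul_left_cancel₀ ha0.ne' this
      linarith
    have hkk : x k = y k := by
      have h1 := horth x hx
      have h2 := horth y hy
      rw [hj, hi] at h1
      have : v k * x k = v k * y k := by linarith
      exact mul_left_cancel₀ hk this
    funext l
    rcases hc l with rfl | rfl | rfl <;> assumption
  rcases S.eq_empty_or_nonempty with rfl | ⟨x0, hx0⟩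
  · left; simp
  have hK0 : 0 ≤ K := by rw [← hnorm x0 hx0]; positivity
  rcases hK0.eq_or_lt with hK0 | hKpos
  · left
    rw [Finset.card_le_one]
    have hz : ∀ x ∈ S, ∀ l, 2 * x l = v l := by
      intro x hx l
      have h := hnorm x hx
      rw [← hK0] at h
      have h1 : (2 * x i - v i) = 0 := by
        rw [← sq_eq_zero_iff]; nlinarith [sq_nonneg (2 * x i - v i), sq_nonneg (2 * x j - v j), sq_nonneg (2 * x k - v k)]
      have h2 : (2 * x j - v j) = 0 := by
        rw [← sq_eq_zero_iff]; nlinarith [sq_nonneg (2 * x i - v i), sq_nonneg (2 * x j - v j), sq_nonneg (2 * x k - v k)]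
      have h3 : (2 * x k - v k) = 0 := by
        rw [← sq_eq_zero_iff]; nlinarith [sq_nonneg (2 * x i - v i), sq_nonneg (2 * x j - v j), sq_nonneg (2 * x k - v k)]
      rcases hc l with rfl | rfl | rfl <;> linarith
    intro x hx y hy
    funext l
    have := hz x hx l; have := hz y hy l; linarith
  · right
    have hMpos : 0 < a * v k ^ 2 * K := by positivity
    have hDpos : 0 < v k ^ 2 * w := by positivity
    obtain ⟨M, hM⟩ := Int.eq_ofNat_of_zero_le hMpos.le
    obtain ⟨D, hD⟩ := Int.eq_ofNat_of_zero_le hDpos.le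
    refine ⟨M, by omega, ?_, ?_⟩
    · have : (M:ℤ) ≤ 64 * m ^ 3 := by
        rw [← hM]
        have hw4 : w ≤ 4 * m := by linarith
        have h1 : a ≤ 4 * m := by nlinarith [sq_nonneg (v j)]
        have h2 : v k ^ 2 ≤ 4 * m := by nlinarith [sq_nonneg (v j), sq_nonneg (v i)]
        have h3 : K ≤ 4 * m := by linarith
        calc a * v k ^ 2 * K ≤ (4 * m) * (4 * m) * (4 * m) := by gcongr
          _ = _ := by ring
      exact_mod_cast this
    · rw [← Finset.card_image_of_injOn hinj]
      apply quad_count D M (by omega) (by omega)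
      intro z hz
      obtain ⟨x, hx, rfl⟩ := mem_image.mp hz
      have := hquad x hx
      rw [hM, hD] at this
      exact this

theorem circle_count (ε : ℝ) (hε : 0 < ε) : ∃ C : ℝ, 1 ≤ C ∧ ∀ m : ℕ, 0 < m →
    ∀ u u' : Fin 3 → ℤ, u ≠ u' → ∀ S : Finset (Fin 3 → ℤ),
    (∀ n ∈ S, ∑ i, (n i - u i) ^ 2 = (m:ℤ) ∧ ∑ i, (n i - u' i) ^ 2 = (m:ℤ)) →
    (S.card : ℝ) ≤ C * (m:ℝ) ^ ε := by
  classical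
  obtain ⟨C, hC1, hC⟩ := divisor_bound (ε / 6) (by positivity)
  refine ⟨10 * C ^ 2 * (64:ℝ) ^ (ε/3), ?_, ?_⟩
  · have h1 : (1:ℝ) ≤ (64:ℝ) ^ (ε/3) := Real.one_le_rpow (by norm_num) (by positivity)
    have h2 : (1:ℝ) ≤ C ^ 2 := one_le_pow₀ hC1
    nlinarith
  intro m hm u u' huu S hS
  have hm1 : (1:ℝ) ≤ m := by exact_mod_cast hm
  have hcard : S.card = (S.image (fun n => n - u)).card :=
    (Finset.card_image_of_injective _ (sub_left_injective)).symm
  rw [hcard]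
  have hS' : ∀ x ∈ S.image (fun n => n - u), ∑ i, (x i)^2 = (m:ℤ) ∧ ∑ i, (x i - (u' - u) i)^2 = (m:ℤ) := by
    intro x hx
    obtain ⟨n, hn, rfl⟩ := mem_image.mp hx
    have := hS n hn
    simpa using this
  set S' := S.image (fun n => n - u)
  have hv : ∃ k, (u' - u) k ≠ 0 := by
    by_contra h
    push Not at h
    apply huu
    funext k
    have := h k
    simp only [Pi.sub_apply] at this
    linarith
  set v := u' - u
  have key : S'.card ≤ 1 ∨ ∃ M : ℕ, 0 < M ∧ M ≤ 64 * m ^ 3 ∧ S'.card ≤ 10 * M.divisors.card * M.divisors.card := by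
    simp only [Fin.sum_univ_three] at hS'
    obtain ⟨k, hk⟩ := hv
    fin_cases k
    · refine circle_core m v 1 2 0 (by decide) hk S' (fun x hx => ?_)
      obtain ⟨h1, h2⟩ := hS' x hx
      constructor <;> linarith
    · refine circle_core m v 0 2 1 (by decide) hk S' (fun x hx => ?_)
      obtain ⟨h1, h2⟩ := hS' x hx
      constructor <;> linarith
    · exact circle_core m v 0 1 2 (by decide) hk S' hS'
  have hmε : (1:ℝ) ≤ (m:ℝ) ^ ε := Real.one_le_rpow hm1 hε.le
  have h64 : (1:ℝ) ≤ (64:ℝ) ^ (ε/3) := Real.one_le_rpow (by norm_num) (by positivity)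
  have h2 : (1:ℝ) ≤ C ^ 2 := one_le_pow₀ hC1
  rcases key with h | ⟨M, hM0, hM, h⟩
  · have h1 : (S'.card : ℝ) ≤ 1 := by exact_mod_cast h
    have : (1:ℝ) ≤ C ^ 2 * (64:ℝ) ^ (ε/3) * (m:ℝ)^ε :=
      one_le_mul_of_one_le_of_one_le (one_le_mul_of_one_le_of_one_le h2 h64) hmε
    nlinarith
  · have h1 : (S'.card : ℝ) ≤ 10 * M.divisors.card * M.divisors.card := by exact_mod_cast h
    have hd := hC M hM0
    have hMr : (M:ℝ) ≤ 64 * m ^ 3 := by exact_mod_cast hM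
    have hMp : (M:ℝ)^(ε/6) ≤ (64 * m ^ 3)^(ε/6) := Real.rpow_le_rpow (by positivity) hMr (by positivity)
    have hd2 : (M.divisors.card:ℝ) ≤ C * (64 * (m:ℝ) ^ 3)^(ε/6) := hd.trans (by gcongr)
    calc (S'.card : ℝ) ≤ 10 * M.divisors.card * M.divisors.card := h1
      _ ≤ 10 * (C * (64 * (m:ℝ) ^ 3)^(ε/6)) * (C * (64 * (m:ℝ) ^ 3)^(ε/6)) := by gcongr
      _ = 10 * C^2 * ((64 * (m:ℝ) ^ 3)^(ε/6) * (64 * (m:ℝ) ^ 3)^(ε/6)) := by ring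
      _ = 10 * C^2 * ((64 * (m:ℝ) ^ 3)^(ε/3)) := by
          rw [← Real.rpow_add (by positivity)]; ring_nf
      _ = _ := by
          rw [Real.mul_rpow (by norm_num) (by positivity), ← Real.rpow_natCast (m:ℝ) 3, ← Real.rpow_mul (by positivity)]
          have : ((3:ℕ):ℝ) * (ε / 3) = ε := by push_cast; ring
          rw [this]; ring

theorem greedy_basis {α E : Type*} [DecidableEq α] [AddCommGroup E] [Module ℝ E]
    (v : α → E) (t : α → ℝ) (p : ℝ) (X : Finset α) :
    (∀ Y ⊆ X, p * (Y.card : ℝ) ≤ Module.finrank ℝ (Submodule.span ℝ (v '' (Y : Set α)))) →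
    ∃ B ⊆ X, LinearIndepOn ℝ v (B : Set α) ∧
      Submodule.span ℝ (v '' (B : Set α)) = Submodule.span ℝ (v '' (X : Set α)) ∧
      ∀ s, (∀ u ∈ X, s ≤ t u) → p * ∑ u ∈ X, (t u - s) ≤ ∑ u ∈ B, (t u - s) := by
  induction X using Finset.induction_on_min_value t with
  | empty =>
    intro _
    exact ⟨∅, by simp, by simp, by simp, by simp⟩
  | insert a Y haY hmin ih =>
    intro hden
    obtain ⟨B, hBY, hB, hsp, hineq⟩ := ih (fun Z hZ => hden Z (hZ.trans (subset_insert _ _)))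
    have haB : a ∉ B := fun h => haY (hBY h)
    have hfin : ∀ B' : Finset α, LinearIndepOn ℝ v (B' : Set α) →
        Module.finrank ℝ (Submodule.span ℝ (v '' (B' : Set α))) = B'.card := by
      intro B' h
      have := finrank_span_eq_card (R := ℝ) (b := fun x : (B' : Set α) => v x) h
      have hr : Set.range (fun x : (B' : Set α) => v x) = v '' (B' : Set α) := by
        ext y; simp
      rw [hr] at this
      simpa using this
    have main : ∀ B' : Finset α, B ⊆ B' → B' ⊆ insert a B → LinearIndepOn ℝ v (B' : Set α) → 
        Submodule.span ℝ (v '' (B' : Set α)) = Submodule.span ℝ (v '' ((insert a Y : Finset α) : Set α)) →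
        ∀ s, (∀ u ∈ insert a Y, s ≤ t u) → p * ∑ u ∈ insert a Y, (t u - s) ≤ ∑ u ∈ B', (t u - s) := by
      intro B' hBB hB'a hli hs s hst
      have h1 := hineq (t a) hmin
      have e1 : ∑ u ∈ B', (t u - s) = ∑ u ∈ B, (t u - t a) + B'.card * (t a - s) := by
        have : ∑ u ∈ B, (t u - t a) = ∑ u ∈ B', (t u - t a) := by
          apply Finset.sum_subset hBB
          intro x hx hx2
          rcases mem_insert.mp (hB'a hx) with h | h
          · rw [h]; ring
          · exact absurd h hx2
        rw [this, ← nsmul_eq_mul, ← sum_const, ← sum_add_distrib]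
        apply sum_congr rfl; intros; ring
      have e2 : ∑ u ∈ insert a Y, (t u - s) = ∑ u ∈ Y, (t u - t a) + (insert a Y).card * (t a - s) := by
        have : ∑ u ∈ Y, (t u - t a) = ∑ u ∈ insert a Y, (t u - t a) := by
          rw [sum_insert haY]; ring
        rw [this, ← nsmul_eq_mul, ← sum_const, ← sum_add_distrib]
        apply sum_congr rfl; intros; ring
      have h2 := hden (insert a Y) (Subset.refl _)
      rw [← hs, hfin B' hli] at h2
      rw [e1, e2, mul_add]
      have h3 : 0 ≤ t a - s := by linarith [hst a (mem_insert_self _ _)]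
      have := mul_le_mul_of_nonneg_right h2 h3
      linarith
    by_cases hmem : v a ∈ Submodule.span ℝ (v '' (B : Set α))
    · have hs : Submodule.span ℝ (v '' (B : Set α)) = Submodule.span ℝ (v '' ((insert a Y : Finset α) : Set α)) := by
        rw [coe_insert, Set.image_insert_eq, Submodule.span_insert, ← hsp]
        symm
        rw [sup_eq_right, Submodule.span_singleton_le_iff_mem]
        exact hmem
      exact ⟨B, hBY.trans (subset_insert _ _), hB, hs, main B (Subset.refl _) (subset_insert _ _) hB hs⟩
    · have hli : LinearIndepOn ℝ v ((insert a B : Finset α) : Set α) := by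
        rw [coe_insert]
        exact hB.insert hmem
      have hs : Submodule.span ℝ (v '' ((insert a B : Finset α) : Set α)) = Submodule.span ℝ (v '' ((insert a Y : Finset α) : Set α)) := by
        simp only [coe_insert, Set.image_insert_eq, Submodule.span_insert, hsp]
      exact ⟨insert a B, insert_subset_insert _ hBY, hli, hs, main _ (subset_insert _ _) (Subset.refl _) hli hs⟩

open Matrix in
theorem det_rank_one {n : Type*} [Fintype n] [DecidableEq n] (A : Matrix n n ℝ) (hA : IsUnit A.det)
    (c : ℝ) (v : n → ℝ) :
    (A + c • vecMulVec v v).det = A.det * (1 + c * (v ⬝ᵥ (A⁻¹ *ᵥ v))) := by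
  have h := det_add_replicateCol_mul_replicateRow (ι := Unit) hA (c • v) v
  have e : replicateCol Unit (c • v) * replicateRow Unit v = c • vecMulVec v v := by
    ext i j
    simp [Matrix.mul_apply, vecMulVec_apply, mul_assoc]
  rw [e] at h
  rw [h]
  congr 1
  rw [det_unique, Matrix.mul_assoc, Matrix.add_apply, Matrix.one_apply_eq]
  simp only [Matrix.mul_apply, replicateRow_apply, replicateCol_apply, Pi.smul_apply, smul_eq_mul, dotProduct, mulVec]
  rw [mul_sum]
  congr 1
  apply sum_congr rfl; intro i _
  rw [mul_sum, mul_sum, mul_sum]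
  apply sum_congr rfl; intro j _
  ring

open Matrix in
/-- weighted Gram matrix -/
def gramW {X n : Type*} (v : X → n → ℝ) (c : X → ℝ) (B : Finset X) : Matrix n n ℝ :=
  ∑ u ∈ B, c u • vecMulVec (v u) (v u)

open Matrix in
theorem gramW_basis {X : Type*} [DecidableEq X] {N : ℕ} (v : X → Fin N → ℝ) (B : Finset X)
    (hB : LinearIndepOn ℝ v (B : Set X)) (hcard : B.card = N) :
    ∃ d : ℝ, 0 < d ∧ ∀ c : X → ℝ, (∀ u, 0 < c u) → (gramW v c B).PosDef ∧ 
      (gramW v c B).det = (∏ u ∈ B, c u) * d := by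
  have e : Fin N ≃ B := (Fin.castOrderIso hcard.symm).toEquiv.trans B.equivFin.symm
  set W : Matrix (Fin N) (Fin N) ℝ := Matrix.of (fun i => v (e i)) with hW
  have hli : LinearIndependent ℝ W.row := by
    have : LinearIndependent ℝ (fun x : (B : Set X) => v x) := hB
    exact this.comp e e.injective
  have hunit : IsUnit W := Matrix.linearIndependent_rows_iff_isUnit.mp hli
  have hdet : W.det ≠ 0 := ((Matrix.isUnit_iff_isUnit_det W).mp hunit).ne_zero
  refine ⟨W.det ^ 2, by positivity, fun c hc => ?_⟩
  have hg : gramW v c B = Wᵀ * diagonal (fun i => c (e i)) * W := by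
    ext i j
    rw [gramW, Matrix.sum_apply, ← Finset.sum_coe_sort]
    rw [Matrix.mul_apply, ← e.sum_comp]
    apply sum_congr rfl
    intro k _
    simp only [Matrix.smul_apply, vecMulVec_apply, Matrix.mul_diagonal, transpose_apply, smul_eq_mul, hW, Matrix.of_apply]
    ring
  rw [hg]
  constructor
  · have hd : (diagonal (fun i => c (e i))).PosDef := Matrix.PosDef.diagonal (fun i => hc _)
    have := hd.conjTranspose_mul_mul_same (B := W) (Matrix.mulVec_injective_of_isUnit hunit)
    simpa using this
  · rw [det_mul, det_mul, det_transpose, det_diagonal, e.prod_comp (fun x : B => c x), Finset.prod_coe_sort]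
    ring

open Matrix in
theorem gramW_mono {X n : Type*} [Fintype n] [DecidableEq n] [DecidableEq X] (v : X → n → ℝ) (c : X → ℝ) (hc : ∀ u, 0 < c u)
    (B : Finset X) (hB : (gramW v c B).PosDef) (Y : Finset X) (hd : Disjoint B Y) :
    (gramW v c (B ∪ Y)).PosDef ∧ (gramW v c B).det ≤ (gramW v c (B ∪ Y)).det := by
  induction Y using Finset.induction_on with
  | empty => simpa using hB
  | insert a Y ha ih =>
    rw [disjoint_insert_right] at hd
    obtain ⟨h1, h2⟩ := ih hd.2
    have e : gramW v c (B ∪ insert a Y) = gramW v c (B ∪ Y) + c a • vecMulVec (v a) (v a) := by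
      rw [union_insert, gramW, sum_insert, add_comm]; rfl
      simp [ha, hd.1]
    rw [e]
    have hpsd : (vecMulVec (v a) (v a)).PosSemidef := by
      simpa using posSemidef_vecMulVec_self_star (v a)
    refine ⟨h1.add_posSemidef (hpsd.smul (hc a).le), h2.trans ?_⟩
    rw [det_rank_one _ ((isUnit_iff_isUnit_det _).mp h1.isUnit)]
    have h3 : 0 ≤ v a ⬝ᵥ ((gramW v c (B ∪ Y))⁻¹ *ᵥ v a) := by
      have := h1.inv.posSemidef.dotProduct_mulVec_nonneg (v a)
      simpa using this
    have h4 := h1.det_pos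
    have := (hc a).le
    nlinarith [mul_nonneg h4.le (mul_nonneg this h3)]

theorem finrank_span_linIndepOn {α E : Type*} [AddCommGroup E] [Module ℝ E]
    (v : α → E) (B : Finset α) (h : LinearIndepOn ℝ v (B : Set α)) :
    Module.finrank ℝ (Submodule.span ℝ (v '' (B : Set α))) = B.card := by
  have := finrank_span_eq_card (R := ℝ) (b := fun x : (B : Set α) => v x) h
  have hr : Set.range (fun x : (B : Set α) => v x) = v '' (B : Set α) := by
    ext y; simp
  rw [hr] at this
  simpa using this

open Matrix in
theorem forster_weights {X : Type*} [Fintype X] [DecidableEq X] [Nonempty X] {N : ℕ} (hN : 0 < N)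
    (v : X → Fin N → ℝ) (hspan : Submodule.span ℝ (Set.range v) = ⊤) (p : ℝ)
    (hp : p * Fintype.card X = N)
    (hden : ∀ Y : Finset X, p * (Y.card : ℝ) ≤ Module.finrank ℝ (Submodule.span ℝ (v '' (Y : Set X)))) :
    ∃ c : X → ℝ, (∀ u, 0 < c u) ∧ (gramW v c univ).PosDef ∧
      ∀ u, p / 2 ≤ c u * (v u ⬝ᵥ ((gramW v c univ)⁻¹ *ᵥ v u)) ∧
        c u * (v u ⬝ᵥ ((gramW v c univ)⁻¹ *ᵥ v u)) ≤ 2 * p := by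
  have hXpos : (0:ℝ) < Fintype.card X := by exact_mod_cast Fintype.card_pos
  have hp0 : 0 < p := by
    have : (0:ℝ) < N := by exact_mod_cast hN
    rw [← hp] at this
    exact pos_of_mul_pos_left this hXpos.le
  have hd : ∀ B : Finset X, ∃ d : ℝ, 0 < d ∧ (LinearIndepOn ℝ v (B : Set X) → B.card = N →
      ∀ c : X → ℝ, (∀ u, 0 < c u) → (gramW v c B).PosDef ∧
      (gramW v c B).det = (∏ u ∈ B, c u) * d) := by
    intro B
    by_cases h : LinearIndepOn ℝ v (B : Set X) ∧ B.card = N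
    · obtain ⟨d, hd, h'⟩ := gramW_basis v B h.1 h.2
      exact ⟨d, hd, fun _ _ => h'⟩
    · exact ⟨1, one_pos, fun h1 h2 => absurd ⟨h1, h2⟩ h⟩
  choose d hd0 hd using hd
  obtain ⟨L, hL⟩ := (Set.finite_range (fun B => Real.log (d B))).bddBelow
  have hL : ∀ B, L ≤ Real.log (d B) := fun B => hL ⟨B, rfl⟩
  set G : (X → ℝ) → Matrix (Fin N) (Fin N) ℝ := fun t => gramW v (fun u => Real.exp (t u)) univ with hG
  set φ : (X → ℝ) → ℝ := fun t => Real.log (G t).det - p * ∑ u, t u with hφ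
  have hmain : ∀ t, (G t).PosDef ∧ L ≤ φ t := by
    intro t
    obtain ⟨B, -, hli, hsp, hin⟩ := greedy_basis v t p univ (fun Y _ => hden Y)
    have hcard : B.card = N := by
      rw [← finrank_span_linIndepOn v B hli, hsp]
      rw [coe_univ, Set.image_univ, hspan, finrank_top]
      simp
    obtain ⟨h1, h2⟩ := hd B hli hcard (fun u => Real.exp (t u)) (fun u => Real.exp_pos _)
    obtain ⟨h3, h4⟩ := gramW_mono v (fun u => Real.exp (t u)) (fun u => Real.exp_pos _) B h1 Bᶜ disjoint_compl_right
    rw [union_compl] at h3 h4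
    refine ⟨h3, ?_⟩
    have h5 : Real.log ((∏ u ∈ B, Real.exp (t u)) * d B) ≤ Real.log (G t).det := by
      rw [← h2]
      exact Real.log_le_log h1.det_pos h4
    rw [← Real.exp_sum, Real.log_mul (Real.exp_pos _).ne' (hd0 B).ne', Real.log_exp] at h5
    obtain ⟨s, hs⟩ := (Set.finite_range t).bddBelow
    have h6 := hin s (fun u _ => hs ⟨u, rfl⟩)
    simp only [sum_sub_distrib, sum_const, nsmul_eq_mul, hcard] at h6
    rw [card_univ, mul_sub, ← mul_assoc, hp] at h6
    have := hL B
    simp only [hφ]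
    linarith
  have hlog2 : 0.6931471803 < Real.log 2 := Real.log_two_gt_d9
  have hlog2' : Real.log 2 < 0.6931471808 := Real.log_two_lt_d9
  set η : ℝ := p * (Real.log 2 - 1 / 2) with hη
  have hη0 : 0 < η := mul_pos hp0 (by linarith)
  have hbdd : BddBelow (Set.range φ) := ⟨L, by rintro _ ⟨t, rfl⟩; exact (hmain t).2⟩
  obtain ⟨_, ⟨t, rfl⟩, ht⟩ := exists_lt_of_csInf_lt (Set.range_nonempty φ) (lt_add_of_pos_right (sInf (Set.range φ)) hη0)
  have hmin : ∀ t', φ t < φ t' + η := fun t' => by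
    have := csInf_le hbdd ⟨t', rfl⟩
    linarith
  refine ⟨fun u => Real.exp (t u), fun u => Real.exp_pos _, (hmain t).1, fun u => ?_⟩
  have hpd := (hmain t).1
  change p / 2 ≤ Real.exp (t u) * (v u ⬝ᵥ ((G t)⁻¹ *ᵥ v u)) ∧
        Real.exp (t u) * (v u ⬝ᵥ ((G t)⁻¹ *ᵥ v u)) ≤ 2 * p
  set l := Real.exp (t u) * (v u ⬝ᵥ ((G t)⁻¹ *ᵥ v u)) with hl
  have hupd : ∀ lam : ℝ, 0 < lam → 0 < 1 + (lam - 1) * l ∧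
      0 < Real.log (1 + (lam - 1) * l) - p * Real.log lam + η := by
    intro lam hlam
    set t' := Function.update t u (t u + Real.log lam) with ht'
    have hsum : ∑ x, t' x = ∑ x, t x + Real.log lam := by
      rw [ht', Finset.sum_update_of_mem (mem_univ u), ← Finset.add_sum_erase univ t (mem_univ u), sdiff_singleton_eq_erase]
      ring
    have hGt : G t' = G t + ((lam - 1) * Real.exp (t u)) • vecMulVec (v u) (v u) := by
      simp only [hG, gramW]
      rw [← Finset.add_sum_erase univ _ (mem_univ u), ← Finset.add_sum_erase univ (fun x => Real.exp (t x) • vecMulVec (v x) (v x)) (mem_univ u)]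
      have : ∀ x ∈ univ.erase u, Real.exp (t' x) • vecMulVec (v x) (v x) = Real.exp (t x) • vecMulVec (v x) (v x) := by
        intro x hx
        rw [ht', Function.update_of_ne (ne_of_mem_erase hx)]
      rw [sum_congr rfl this]
      have h2 : Real.exp (t' u) = Real.exp (t u) + (lam - 1) * Real.exp (t u) := by
        rw [ht', Function.update_self, Real.exp_add, Real.exp_log hlam]; ring
      rw [h2, add_smul]
      abel
    have hdet : (G t').det = (G t).det * (1 + (lam - 1) * l) := by
      rw [hGt, det_rank_one _ ((isUnit_iff_isUnit_det _).mp hpd.isUnit), hl]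
      ring
    have hpos : 0 < 1 + (lam - 1) * l := by
      have := (hmain t').1.det_pos
      rw [hdet] at this
      exact pos_of_mul_pos_right this hpd.det_pos.le
    refine ⟨hpos, ?_⟩
    have h := hmin t'
    simp only [hφ] at h
    rw [hdet, Real.log_mul hpd.det_pos.ne' hpos.ne', hsum] at h
    linarith
  constructor
  · obtain ⟨h1, h2⟩ := hupd 2 (by norm_num)
    have h3 : Real.log (1 + (2 - 1) * l) ≤ (2 - 1) * l := by
      have := Real.log_le_sub_one_of_pos h1; linarith
    rw [hη] at h2
    generalize Real.log (1 + (2 - 1) * l) = q at h2 h3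
    linarith
  · obtain ⟨h1, h2⟩ := hupd (1/2) (by norm_num)
    have h3 : Real.log (1 + (1/2 - 1) * l) ≤ (1/2 - 1) * l := by
      have := Real.log_le_sub_one_of_pos h1; linarith
    rw [one_div, Real.log_inv] at h2
    rw [hη] at h2
    rw [one_div] at h3
    nlinarith

open Matrix in
theorem trace_sq_le_rank {n : Type*} [Fintype n] [DecidableEq n] (A : Matrix n n ℝ) (hA : A.IsHermitian) :
    A.trace ^ 2 ≤ A.rank * ∑ i, ∑ j, A i j ^ 2 := by
  have h1 : A.trace = ∑ i, hA.eigenvalues i := by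
    have := hA.trace_eq_sum_eigenvalues
    simpa using this
  have h2 : ∑ i, ∑ j, A i j ^ 2 = ∑ i, hA.eigenvalues i ^ 2 := by
    have e1 : ∑ i, ∑ j, A i j ^ 2 = (A * A).trace := by
      simp only [Matrix.trace, Matrix.diag, Matrix.mul_apply]
      apply sum_congr rfl; intro i _; apply sum_congr rfl; intro j _
      have : A j i = A i j := by
        have := hA.apply i j
        simpa using this
      rw [this, sq]
    rw [e1]
    conv_lhs => rw [hA.spectral_theorem]
    rw [← map_mul, Unitary.conjStarAlgAut_apply, Matrix.trace_mul_comm, ← Matrix.mul_assoc]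
    simp [Matrix.trace, Matrix.diag, sq]
  have h3 : (A.rank:ℝ) = ((univ.filter fun i => hA.eigenvalues i ≠ 0).card : ℝ) := by
    rw [hA.rank_eq_card_non_zero_eigs, Fintype.card_subtype]
  rw [h1, h2, h3, ← Finset.sum_filter_ne_zero univ (f := hA.eigenvalues)]
  refine (sq_sum_le_card_mul_sum_sq (s := univ.filter fun i => hA.eigenvalues i ≠ 0) (f := hA.eigenvalues)).trans ?_
  gcongr
  exact filter_subset _ _

open Matrix in
theorem forster_kernel0 {X : Type*} [Fintype X] [DecidableEq X] [Nonempty X] {N : ℕ} (hN : 0 < N)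
    (v : X → Fin N → ℝ) (hspan : Submodule.span ℝ (Set.range v) = ⊤) (p : ℝ)
    (hp : p * Fintype.card X = N)
    (hden : ∀ Y : Finset X, p * (Y.card : ℝ) ≤ Module.finrank ℝ (Submodule.span ℝ (v '' (Y : Set X)))) :
    ∃ K : Matrix X X ℝ, (∀ u, p / 2 ≤ K u u ∧ K u u ≤ 2 * p) ∧ ∑ u, ∑ u', K u u' ^ 2 = N ∧
      ∀ S : Finset X, (∑ u ∈ S, K u u) ^ 2 ≤ 
        Module.finrank ℝ (Submodule.span ℝ (v '' (S : Set X))) * ∑ u ∈ S, ∑ u' ∈ S, K u u' ^ 2 := by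
  obtain ⟨c, hc, hpd, hb⟩ := forster_weights hN v hspan p hp hden
  set G := gramW v c univ with hG
  set W : Matrix X (Fin N) ℝ := Matrix.of (fun u i => Real.sqrt (c u) * v u i) with hW
  have hGW : G = Wᵀ * W := by
    ext i j
    rw [hG, gramW, Matrix.sum_apply, Matrix.mul_apply]
    apply sum_congr rfl
    intro u _
    simp only [Matrix.smul_apply, vecMulVec_apply, transpose_apply, smul_eq_mul, hW, Matrix.of_apply]
    have := Real.mul_self_sqrt (hc u).le
    linear_combination (-(v u i * v u j)) * this
  have hunit : IsUnit G.det := (isUnit_iff_isUnit_det _).mp hpd.isUnit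
  set K : Matrix X X ℝ := W * G⁻¹ * Wᵀ with hK
  have hGt : Gᵀ = G := by rw [hGW]; simp
  have hKt : Kᵀ = K := by
    rw [hK, Matrix.transpose_mul, Matrix.transpose_mul, Matrix.transpose_transpose, Matrix.transpose_nonsing_inv, hGt, Matrix.mul_assoc]
  have hKK : K * K = K := by
    calc K * K = W * G⁻¹ * (Wᵀ * W) * G⁻¹ * Wᵀ := by simp only [hK, Matrix.mul_assoc]
      _ = W * (G⁻¹ * G) * G⁻¹ * Wᵀ := by rw [← hGW]; simp only [Matrix.mul_assoc]
      _ = K := by rw [Matrix.nonsing_inv_mul _ hunit, Matrix.mul_one]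
  have htr : K.trace = N := by
    rw [hK, Matrix.mul_assoc, Matrix.trace_mul_comm, Matrix.mul_assoc, ← hGW, Matrix.nonsing_inv_mul _ hunit]
    simp
  have hKuu : ∀ u, K u u = c u * (v u ⬝ᵥ (G⁻¹ *ᵥ v u)) := by
    intro u
    rw [hK, Matrix.mul_assoc, Matrix.mul_apply]
    simp only [dotProduct, mulVec, Matrix.mul_apply, transpose_apply, hW, Matrix.of_apply]
    rw [mul_sum]
    apply sum_congr rfl; intro i _
    rw [mul_sum, mul_sum, mul_sum]
    apply sum_congr rfl; intro j _
    have := Real.mul_self_sqrt (hc u).le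
    linear_combination (v u i * v u j * G⁻¹ i j) * this
  refine ⟨K, fun u => by rw [hKuu]; exact hb u, ?_, ?_⟩
  · have htr2 : (K * K).trace = N := by rw [hKK, htr]
    rw [← htr2]
    simp only [Matrix.trace, Matrix.diag, Matrix.mul_apply]
    apply sum_congr rfl; intro i _; apply sum_congr rfl; intro j _
    have : K j i = K i j := by
      conv_lhs => rw [← hKt]
      rfl
    rw [this, sq]
  · intro S
    set A : Matrix S S ℝ := K.submatrix (fun x : S => (x : X)) (fun x : S => (x:X)) with hA
    have hAh : A.IsHermitian := by
      rw [Matrix.IsHermitian]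
      ext i j
      have : K j i = K i j := by
        conv_lhs => rw [← hKt]
        rfl
      simpa [hA] using this
    have h := trace_sq_le_rank A hAh
    have e1 : A.trace = ∑ u ∈ S, K u u := by
      rw [← Finset.sum_coe_sort]; rfl
    have e2 : ∑ i, ∑ j, A i j ^ 2 = ∑ u ∈ S, ∑ u' ∈ S, K u u' ^ 2 := by
      rw [← Finset.sum_coe_sort S]
      apply sum_congr rfl; intro i _
      rw [← Finset.sum_coe_sort S]; rfl
    rw [e1, e2] at h
    refine h.trans ?_
    gcongr
    have e3 : A = (W.submatrix (fun x : S => (x : X)) id) * (G⁻¹ * (Wᵀ.submatrix id (fun x : S => (x : X)))) := by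
      rw [hA, hK, Matrix.mul_assoc]
      ext i j
      simp [Matrix.mul_apply]
    rw [e3]
    refine (Matrix.rank_mul_le_left _ _).trans ?_
    rw [Matrix.rank_eq_finrank_span_row]
    apply Submodule.finrank_mono
    rw [Submodule.span_le]
    rintro _ ⟨u, rfl⟩
    have : (W.submatrix (fun x : S => (x : X)) id).row u = Real.sqrt (c u) • v u := by
      ext i; simp [hW, Matrix.row]
    rw [this]
    exact Submodule.smul_mem _ _ (Submodule.subset_span ⟨u, u.2, rfl⟩)

theorem forster_kernel1 {X E : Type*} [Fintype X] [DecidableEq X] [Nonempty X]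
    [AddCommGroup E] [Module ℝ E] (N : ℕ) (hN : 0 < N) (v : X → E)
    (hspan : Module.finrank ℝ (Submodule.span ℝ (Set.range v)) = N) (p : ℝ)
    (hp : p * Fintype.card X = N)
    (hden : ∀ Y : Finset X, p * (Y.card : ℝ) ≤ Module.finrank ℝ (Submodule.span ℝ (v '' (Y : Set X)))) :
    ∃ K : X → X → ℝ, (∀ u, p / 2 ≤ K u u ∧ K u u ≤ 2 * p) ∧ ∑ u, ∑ u', K u u' ^ 2 = N ∧
      ∀ S : Finset X, (∑ u ∈ S, K u u) ^ 2 ≤ 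
        Module.finrank ℝ (Submodule.span ℝ (v '' (S : Set X))) * ∑ u ∈ S, ∑ u' ∈ S, K u u' ^ 2 := by
  set W := Submodule.span ℝ (Set.range v) with hW
  have hfd : Module.Finite ℝ W := FiniteDimensional.span_of_finite ℝ (Set.finite_range v)
  let e : W ≃ₗ[ℝ] (Fin N → ℝ) := (Module.finBasisOfFinrankEq ℝ W hspan).equivFun
  let w : X → W := fun u => ⟨v u, Submodule.subset_span ⟨u, rfl⟩⟩
  have hfin : ∀ Y : Set X, Module.finrank ℝ (Submodule.span ℝ ((fun u => e (w u)) '' Y)) =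
      Module.finrank ℝ (Submodule.span ℝ (v '' Y)) := by
    intro Y
    have h1 : Submodule.span ℝ ((fun u => e (w u)) '' Y) = (Submodule.span ℝ (w '' Y)).map (e : W →ₗ[ℝ] (Fin N → ℝ)) := by
      rw [Submodule.map_span, ← Set.image_comp]; rfl
    have h2 : Submodule.span ℝ (v '' Y) = (Submodule.span ℝ (w '' Y)).map W.subtype := by
      rw [Submodule.map_span, ← Set.image_comp]; rfl
    rw [h1, h2, Submodule.finrank_map_subtype_eq]
    exact LinearEquiv.finrank_map_eq e _
  have hsp : Submodule.span ℝ (Set.range (fun u => e (w u))) = ⊤ := by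
    apply Submodule.eq_top_of_finrank_eq
    rw [← Set.image_univ, hfin, Set.image_univ, hspan]
    simp
  obtain ⟨K, h1, h2, h3⟩ := forster_kernel0 hN (fun u => e (w u)) hsp p hp (fun Y => by rw [hfin]; exact hden Y)
  refine ⟨K, h1, h2, fun S => ?_⟩
  have := h3 S
  rwa [hfin] at this

theorem forster_kernel {α E : Type*} [DecidableEq α] 
    [AddCommGroup E] [Module ℝ E] (v : α → E) (X : Finset α) (hX : X.Nonempty) (h : Finset α → ℕ)
    (hdef : ∀ Y, h Y = Module.finrank ℝ (Submodule.span ℝ (v '' (Y : Set α))))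
    (hN : 0 < h X) (p : ℝ)
    (hp : p * X.card = h X)
    (hden : ∀ Y ⊆ X, p * (Y.card : ℝ) ≤ h Y) :
    ∃ K : α → α → ℝ, (∀ u ∈ X, p / 2 ≤ K u u ∧ K u u ≤ 2 * p) ∧ ∑ u ∈ X, ∑ u' ∈ X, K u u' ^ 2 = h X ∧
      ∀ S ⊆ X, (∑ u ∈ S, K u u) ^ 2 ≤ h S * ∑ u ∈ S, ∑ u' ∈ S, K u u' ^ 2 := by
  have : Nonempty X := hX.coe_sort
  have hr : Set.range (fun u : X => v u) = v '' (X : Set α) := by ext y; simp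
  obtain ⟨K, h1, h2, h3⟩ := forster_kernel1 (X := X) (h X) hN (fun u => v u) (by rw [hr, hdef]) p (by simpa using hp)
    (fun Y => by
      have := hden (Y.map (Function.Embedding.subtype _)) (by intro x; simp; intro h _; exact h)
      have hi : (fun u : X => v u) '' (Y : Set X) = v '' ((Y.map (Function.Embedding.subtype _) : Finset α) : Set α) := by
        rw [coe_map, ← Set.image_comp]; rfl
      rw [hdef, card_map] at this
      rw [hi]; exact this)
  let K' : α → α → ℝ := fun u u' => if hu : u ∈ X ∧ u' ∈ X then K ⟨u, hu.1⟩ ⟨u', hu.2⟩ else 0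
  have hK' : ∀ u u' : X, K' u u' = K u u' := by
    intro u u'
    simp [K']
  refine ⟨K', fun u hu => ?_, ?_, fun S hS => ?_⟩
  · have := h1 ⟨u, hu⟩
    rwa [← hK'] at this
  · rw [← h2, ← Finset.sum_coe_sort]
    apply sum_congr rfl; intro u _
    rw [← Finset.sum_coe_sort]
    apply sum_congr rfl; intro u' _
    rw [hK']
  · have := h3 (S.subtype (· ∈ X))
    simp only [← hK'] at this
    rw [Finset.sum_subtype_of_mem (fun u => K' u u) hS] at this
    rw [Finset.sum_subtype_of_mem (fun u => ∑ u' ∈ S.subtype (· ∈ X), K' u u' ^ 2) hS] at this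
    have hin : ∀ u, ∑ u' ∈ S.subtype (· ∈ X), K' u u' ^ 2 = ∑ u' ∈ S, K' u u' ^ 2 :=
      fun u => Finset.sum_subtype_of_mem (fun u' => K' u u' ^ 2) hS
    simp only [hin] at this
    have hi : (fun u : X => v u) '' ((S.subtype (· ∈ X) : Finset X) : Set X) = v '' (S : Set α) := by
      ext y
      simp only [Set.mem_image, mem_coe, mem_subtype]
      constructor
      · rintro ⟨a, ha, rfl⟩; exact ⟨a, ha, rfl⟩
      · rintro ⟨a, ha, rfl⟩; exact ⟨⟨a, hS ha⟩, ha, rfl⟩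
    rw [hi] at this
    rw [hdef]; exact this

theorem span_half {ι α : Type*} [DecidableEq ι] [DecidableEq α] (F : ι → α → ℝ) (M : Finset ι) (X : Finset α) :
    Module.finrank ℝ (Submodule.span ℝ ((fun u => fun e => if e ∈ M then F e u else 0) '' (X : Set α))) =
    (Matrix.of (fun (e : M) (u : X) => F e u)).rank := by
  rw [Matrix.rank_eq_finrank_span_cols]
  set ext := Function.ExtendByZero.linearMap ℝ (Subtype.val : M → ι) with hext
  have hinj : Function.Injective ext := Function.extend_injective Subtype.val_injective (0 : ι → ℝ)
  have : Submodule.span ℝ ((fun u => fun e => if e ∈ M then F e u else 0) '' (X : Set α)) =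
      (Submodule.span ℝ (Set.range (Matrix.of (fun (e : M) (u : X) => F e u)).col)).map ext := by
    rw [Submodule.map_span, ← Set.range_comp]
    congr 1
    have h1 : ∀ u : X, ext ((Matrix.of (fun (e : M) (u : X) => F e u)).col u) = (fun e => if e ∈ M then F e u else 0) := by
      intro u
      ext e
      change Function.extend Subtype.val _ (0 : ι → ℝ) e = _
      split_ifs with h
      · have : e = ((⟨e, h⟩ : M) : ι) := rfl
        rw [this, Subtype.val_injective.extend_apply]
        rfl
      · rw [Function.extend_apply' _ _ _ (by rintro ⟨a, rfl⟩; exact h a.2)]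
        rfl
    ext y
    constructor
    · rintro ⟨u, hu, rfl⟩
      exact ⟨⟨u, hu⟩, h1 _⟩
    · rintro ⟨u, rfl⟩
      exact ⟨u, u.2, (h1 u).symm⟩
  rw [this]
  exact (Submodule.equivMapOfInjective ext hinj _).finrank_eq.symm

theorem span_row_col {ι α : Type*} [DecidableEq ι] [DecidableEq α] (F : ι → α → ℝ) (M : Finset ι) (X : Finset α) :
    Module.finrank ℝ (Submodule.span ℝ ((fun u => fun e => if e ∈ M then F e u else 0) '' (X : Set α))) =
    Module.finrank ℝ (Submodule.span ℝ ((fun e => fun u => if u ∈ X then F e u else 0) '' (M : Set ι))) := by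
  rw [span_half, span_half (fun u e => F e u), ← Matrix.rank_transpose]
  rfl

theorem greedy_card {ι κ E : Type*} [DecidableEq ι] [LinearOrder κ] [AddCommGroup E] [Module ℝ E]
    (f : ι → κ) (hf : Function.Injective f) (v : ι → E) (M : Finset ι) (B : Finset ι)
    (hB : ∀ e, e ∈ B ↔ e ∈ M ∧ v e ∉ Submodule.span ℝ (v '' {e' | e' ∈ M ∧ f e' < f e})) :
    B.card = Module.finrank ℝ (Submodule.span ℝ (v '' (M : Set ι))) := by
  have key : LinearIndepOn ℝ v (B : Set ι) ∧ Submodule.span ℝ (v '' (B : Set ι)) = Submodule.span ℝ (v '' (M : Set ι)) := by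
    induction M using Finset.induction_on_max_value f generalizing B with
    | empty =>
      have : B = ∅ := by ext e; simp [hB e]
      subst this
      simp
    | insert a M ha hmax ih =>
      have hlt : ∀ e ∈ M, f e < f a := fun e he =>
        lt_of_le_of_ne (hmax e he) (fun h => ha (hf h ▸ he))
      have hset : ∀ e ∈ M, {e' | e' ∈ insert a M ∧ f e' < f e} = {e' | e' ∈ M ∧ f e' < f e} := by
        intro e he
        ext e'
        simp only [mem_insert, Set.mem_ofPred_eq]
        constructor
        · rintro ⟨rfl | h, h2⟩
          · exact absurd h2 (not_lt.mpr (hlt e he).le)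
          · exact ⟨h, h2⟩
        · rintro ⟨h, h2⟩; exact ⟨Or.inr h, h2⟩
      have hseta : {e' | e' ∈ insert a M ∧ f e' < f a} = (M : Set ι) := by
        ext e'
        simp only [mem_insert, Set.mem_ofPred_eq, mem_coe]
        constructor
        · rintro ⟨rfl | h, h2⟩
          · exact absurd h2 (lt_irrefl _)
          · exact h
        · intro h; exact ⟨Or.inr h, hlt _ h⟩
      obtain ⟨h1, h2⟩ := ih (B.erase a) (by
        intro e
        rw [mem_erase, hB]
        constructor
        · rintro ⟨hne, hm, hs⟩
          have hm' : e ∈ M := (mem_insert.mp hm).resolve_left hne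
          rw [hset e hm'] at hs
          exact ⟨hm', hs⟩
        · rintro ⟨hm, hs⟩
          rw [← hset e hm] at hs
          exact ⟨fun h => ha (h ▸ hm), mem_insert_of_mem hm, hs⟩)
      by_cases haB : a ∈ B
      · have hnot : v a ∉ Submodule.span ℝ (v '' ((B.erase a : Finset ι) : Set ι)) := by
          have := ((hB a).mp haB).2
          rw [hseta] at this
          rw [h2]; exact this
        have hBe : (B : Set ι) = insert a ((B.erase a : Finset ι) : Set ι) := by
          rw [← coe_insert, insert_erase haB]
        rw [hBe]
        refine ⟨h1.insert hnot, ?_⟩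
        simp only [coe_insert, Set.image_insert_eq, Submodule.span_insert, h2]
      · rw [erase_eq_of_notMem haB] at h1 h2
        refine ⟨h1, ?_⟩
        have hin : v a ∈ Submodule.span ℝ (v '' (M : Set ι)) := by
          by_contra hc
          apply haB
          rw [hB, hseta]
          exact ⟨mem_insert_self _ _, hc⟩
        rw [coe_insert, Set.image_insert_eq, Submodule.span_insert, h2]
        symm
        rw [sup_eq_right, Submodule.span_singleton_le_iff_mem]
        exact hin
  rw [← key.2, finrank_span_linIndepOn v B key.1]

/-- homogeneous coordinates -/
def hat (u : Fin 3 → ℤ) : Fin 4 → ℝ := Fin.cons 1 (fun i => (u i : ℝ))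

/-- monomial evaluation -/
def monv (e : Fin 4 → ℕ) (u : Fin 3 → ℤ) : ℝ := ∏ i, hat u i ^ e i

/-- exponents of degree D -/
def Mon (D : ℕ) : Finset (Fin 4 → ℕ) := piAntidiag univ D

theorem mem_Mon {D : ℕ} {e : Fin 4 → ℕ} : e ∈ Mon D ↔ ∑ i, e i = D := by
  simp [Mon]

/-- Veronese vector -/
def vcol (D : ℕ) (u : Fin 3 → ℤ) : (Fin 4 → ℕ) → ℝ := fun e => if e ∈ Mon D then monv e u else 0

/-- Hilbert function -/
def hil (D : ℕ) (X : Finset (Fin 3 → ℤ)) : ℕ :=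
  Module.finrank ℝ (Submodule.span ℝ (vcol D '' (X : Set (Fin 3 → ℤ))))

/-- row function -/
def rowf (X : Finset (Fin 3 → ℤ)) (e : Fin 4 → ℕ) : (Fin 3 → ℤ) → ℝ := fun u => if u ∈ X then monv e u else 0

theorem hil_row (D : ℕ) (X : Finset (Fin 3 → ℤ)) :
    hil D X = Module.finrank ℝ (Submodule.span ℝ (rowf X '' (Mon D : Set (Fin 4 → ℕ)))) :=
  span_row_col monv (Mon D) X

theorem hil_le (D : ℕ) (X : Finset (Fin 3 → ℤ)) : hil D X ≤ (D + 1) ^ 3 := by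
  classical
  rw [hil_row]
  have h1 : Module.finrank ℝ (Submodule.span ℝ (rowf X '' (Mon D : Set (Fin 4 → ℕ)))) ≤ (Mon D).card := by
    rw [← coe_image]
    exact (finrank_span_finset_le_card _).trans card_image_le
  refine h1.trans ?_
  have : (Mon D).card ≤ (Fintype.piFinset (fun _ : Fin 3 => range (D+1))).card := by
    apply Finset.card_le_card_of_injOn (fun e => fun i => e (Fin.succ i))
    · intro e he
      have he := mem_Mon.mp he
      rw [Fin.sum_univ_succ] at he
      simp only [Fintype.coe_piFinset, coe_range, Set.mem_pi, Set.mem_univ, Set.mem_Iio, true_implies]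
      intro i
      have := Finset.single_le_sum (f := fun i : Fin 3 => e i.succ) (fun _ _ => Nat.zero_le _) (mem_univ i)
      omega
    · intro e he e' he' h
      have he := mem_Mon.mp he
      have he' := mem_Mon.mp he'
      rw [Fin.sum_univ_succ] at he he'
      have h2 : ∀ i : Fin 3, e i.succ = e' i.succ := fun i => congrFun h i
      simp only [h2] at he
      have h0 : e 0 = e' 0 := by omega
      funext i
      refine Fin.cases h0 h2 i
  simpa using this

theorem hil_mono (D : ℕ) {X Y : Finset (Fin 3 → ℤ)} (h : X ⊆ Y) : hil D X ≤ hil D Y := by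
  unfold hil
  have : Module.Finite ℝ (Submodule.span ℝ (vcol D '' (Y : Set (Fin 3 → ℤ)))) :=
    FiniteDimensional.span_of_finite ℝ (Y.finite_toSet.image _)
  apply Submodule.finrank_mono
  apply Submodule.span_mono
  exact Set.image_mono (by exact_mod_cast h)

theorem hil_pos (D : ℕ) {X : Finset (Fin 3 → ℤ)} (h : X.Nonempty) : 0 < hil D X := by
  obtain ⟨u, hu⟩ := h
  have : Module.Finite ℝ (Submodule.span ℝ (vcol D '' (X : Set (Fin 3 → ℤ)))) :=
    FiniteDimensional.span_of_finite ℝ (X.finite_toSet.image _)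
  rw [hil, Module.finrank_pos_iff_exists_ne_zero]
  refine ⟨⟨vcol D u, Submodule.subset_span ⟨u, hu, rfl⟩⟩, ?_⟩
  intro h0
  have h1 : vcol D u = 0 := congrArg Subtype.val h0
  have h2 := congrFun h1 (Pi.single 0 D)
  have h3 : (Pi.single 0 D : Fin 4 → ℕ) ∈ Mon D := by rw [mem_Mon]; simp
  rw [vcol, if_pos h3, monv, Fin.prod_univ_succ] at h2
  simp [hat] at h2

theorem hat_add (e : Fin 4 → ℕ) (i : Fin 4) (u : Fin 3 → ℤ) :
    monv (e + Pi.single i 1) u = hat u i * monv e u := by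
  simp only [monv, Pi.add_apply, pow_add, prod_mul_distrib]
  rw [mul_comm]
  congr 1
  rw [Finset.prod_eq_single i]
  · simp
  · intro j _ hj; simp [hj]
  · simp

theorem hil_shadow (D : ℕ) (X : Finset (Fin 3 → ℤ)) : (D + 1) * hil (D + 1) X ≤ (D + 4) * hil D X := by
  classical
  let f : (Fin 4 → ℕ) → Lex (Fin 4 → ℕ) := toLex
  have hf : Function.Injective f := toLex.injective
  let B : ℕ → Finset (Fin 4 → ℕ) := fun D => (Mon D).filter (fun e =>
    rowf X e ∉ Submodule.span ℝ (rowf X '' {e' | e' ∈ Mon D ∧ f e' < f e}))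
  have hBcard : ∀ D, (B D).card = hil D X := by
    intro D
    rw [hil_row]
    exact greedy_card f hf (rowf X) (Mon D) (B D) (fun e => by simp only [B, mem_filter]; exact Iff.rfl)
  have hshadow : ∀ e i, e + Pi.single i 1 ∈ B (D+1) → e ∈ B D := by
    intro e i he
    simp only [B, mem_filter] at he ⊢
    obtain ⟨h1, h2⟩ := he
    have hs1 : ∀ e : Fin 4 → ℕ, ∑ j, (e + Pi.single i 1 : Fin 4 → ℕ) j = ∑ j, e j + 1 := by
      intro e; simp [sum_add_distrib]
    have hm : e ∈ Mon D := by
      rw [mem_Mon] at h1 ⊢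
      rw [hs1] at h1; omega
    refine ⟨hm, fun h3 => h2 ?_⟩
    let mulx : ((Fin 3 → ℤ) → ℝ) →ₗ[ℝ] ((Fin 3 → ℤ) → ℝ) :=
      { toFun := fun g u => hat u i * g u
        map_add' := by intro a b; funext u; simp [mul_add]
        map_smul' := by intro a b; funext u; simp; ring }
    have hmulx : ∀ e, mulx (rowf X e) = rowf X (e + Pi.single i 1) := by
      intro e
      funext u
      change hat u i * (if u ∈ X then monv e u else 0) = if u ∈ X then monv (e + Pi.single i 1) u else 0
      split_ifs
      · rw [hat_add]
      · simp
    rw [← hmulx]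
    have h4 := Submodule.mem_map_of_mem (f := mulx) h3
    rw [Submodule.map_span] at h4
    refine Submodule.span_mono ?_ h4
    rintro _ ⟨_, ⟨e', ⟨he', hlt⟩, rfl⟩, rfl⟩
    refine ⟨e' + Pi.single i 1, ⟨?_, ?_⟩, (hmulx e').symm⟩
    · rw [mem_Mon] at he' ⊢
      rw [hs1, he']
    · change toLex e' + toLex (Pi.single i 1) < toLex e + toLex (Pi.single i 1)
      exact add_lt_add_left hlt _
  rw [← hBcard, ← hBcard]
  calc (D + 1) * (B (D+1)).card = ∑ e ∈ B (D+1), ∑ i, e i := by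
        rw [sum_congr rfl (g := fun _ => D + 1), sum_const, smul_eq_mul, mul_comm]
        intro e he
        exact mem_Mon.mp (mem_filter.mp he).1
    _ = ∑ i, ∑ e ∈ B (D+1), e i := sum_comm
    _ ≤ ∑ i, ∑ e ∈ B D, (e i + 1) := by
        apply sum_le_sum
        intro i _
        rw [← Finset.sum_filter_ne_zero]
        have hinj : Set.InjOn (fun e : Fin 4 → ℕ => e + Pi.single i 1) (B D) := fun a _ b _ h => add_right_cancel h
        have : ∑ e ∈ B D, (e i + 1) = ∑ e ∈ (B D).image (fun e => e + Pi.single i 1), e i := by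
          rw [sum_image hinj]
          apply sum_congr rfl; intro e _; simp
        rw [this]
        apply sum_le_sum_of_subset
        intro e he
        rw [mem_filter] at he
        have hee : (e - Pi.single i 1) + Pi.single i 1 = e := by
          funext j
          by_cases hj : j = i
          · subst hj; simp; omega
          · simp [hj]
        rw [mem_image]
        refine ⟨e - Pi.single i 1, hshadow _ i ?_, hee⟩
        rw [hee]; exact he.1
    _ = ∑ e ∈ B D, ∑ i, (e i + 1) := sum_comm
    _ = (D + 4) * (B D).card := by
        rw [sum_congr rfl (g := fun _ => D + 4), sum_const, smul_eq_mul, mul_comm]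
        intro e he
        have := mem_Mon.mp (mem_filter.mp he).1
        rw [sum_add_distrib, this]; simp

theorem monv_two (e : Fin 4 → ℕ) (i j : Fin 4) (u : Fin 3 → ℤ) :
    monv (e + Pi.single i 1 + Pi.single j 1) u = hat u j * hat u i * monv e u := by
  rw [hat_add, hat_add]; ring

theorem mem_Mon_two (D : ℕ) (e : Fin 4 → ℕ) (i j : Fin 4) :
    e + Pi.single i 1 + Pi.single j 1 ∈ Mon (D + 2) ↔ e ∈ Mon D := by
  rw [mem_Mon, mem_Mon]
  have : ∑ k, (e + Pi.single i 1 + Pi.single j 1 : Fin 4 → ℕ) k = ∑ k, e k + 2 := by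
    simp [sum_add_distrib]
  rw [this]; omega

/-- successor with fixed type -/
def sc (i : Fin 3) : Fin 4 := Fin.succ i

/-- multiplication by the sphere polynomial, transposed -/
def sphT (n : Fin 3 → ℤ) (m : ℕ) : ((Fin 4 → ℕ) → ℝ) →ₗ[ℝ] ((Fin 4 → ℕ) → ℝ) where
  toFun y e := ∑ i : Fin 3, (y (e + Pi.single (sc i) 1 + Pi.single (sc i) 1)
      - 2 * (n i : ℝ) * y (e + Pi.single 0 1 + Pi.single (sc i) 1)
      + (n i : ℝ) ^ 2 * y (e + Pi.single 0 1 + Pi.single 0 1)) - m * y (e + Pi.single 0 1 + Pi.single 0 1)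
  map_add' a b := by
    funext e
    simp only [Fin.sum_univ_three, Pi.add_apply]
    ring
  map_smul' a b := by
    funext e
    simp only [Fin.sum_univ_three, Pi.smul_apply, smul_eq_mul, RingHom.id_apply]
    ring

theorem sphT_vcol (n : Fin 3 → ℤ) (m D : ℕ) (u : Fin 3 → ℤ) :
    sphT n m (vcol (D + 2) u) = (((∑ i, (n i - u i) ^ 2 - (m : ℤ) : ℤ)) : ℝ) • vcol D u := by
  funext e
  have key : ∀ i j : Fin 4, vcol (D + 2) u (e + Pi.single i 1 + Pi.single j 1) = hat u j * hat u i * vcol D u e := by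
    intro i j
    simp only [vcol, mem_Mon_two, monv_two]
    split_ifs <;> simp
  have h0 : hat u 0 = 1 := rfl
  have h1 : ∀ i : Fin 3, hat u (sc i) = (u i : ℝ) := fun i => by simp [hat, sc]
  simp only [sphT, LinearMap.coe_mk, AddHom.coe_mk, Pi.smul_apply, smul_eq_mul, key, h0, h1, Fin.sum_univ_three]
  push_cast
  ring

theorem hil_split (n : Fin 3 → ℤ) (m D : ℕ) (X : Finset (Fin 3 → ℤ)) :
    hil (D + 2) (X.filter (fun u => ∑ i, (n i - u i) ^ 2 = (m : ℤ))) +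
      hil D (X.filter (fun u => ¬ ∑ i, (n i - u i) ^ 2 = (m : ℤ))) ≤ hil (D + 2) X := by
  set W := Submodule.span ℝ (vcol (D + 2) '' (X : Set (Fin 3 → ℤ))) with hW
  have hfin : Module.Finite ℝ W := FiniteDimensional.span_of_finite ℝ (X.finite_toSet.image _)
  let g := (sphT n m).domRestrict W
  have hrn := LinearMap.finrank_range_add_finrank_ker g
  have hX : hil (D + 2) X = Module.finrank ℝ W := rfl
  rw [hX, ← hrn, add_comm]
  apply Nat.add_le_add
  · unfold hil
    apply Submodule.finrank_mono
    rw [Submodule.span_le]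
    rintro _ ⟨u, hu, rfl⟩
    rw [mem_coe, mem_filter] at hu
    have hne : (((∑ i, (n i - u i) ^ 2 - (m : ℤ) : ℤ)) : ℝ) ≠ 0 := by
      exact_mod_cast sub_ne_zero.mpr hu.2
    have hmem : vcol (D + 2) u ∈ W := Submodule.subset_span ⟨u, hu.1, rfl⟩
    have h1 : (((∑ i, (n i - u i) ^ 2 - (m : ℤ) : ℤ)) : ℝ) • vcol D u ∈ LinearMap.range g := by
      refine ⟨⟨_, hmem⟩, ?_⟩
      exact sphT_vcol n m D u
    exact (Submodule.smul_mem_iff _ hne).mp h1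
  · unfold hil
    rw [← Submodule.finrank_map_subtype_eq W (LinearMap.ker g)]
    have : Module.Finite ℝ ((LinearMap.ker g).map W.subtype) := inferInstance
    apply Submodule.finrank_mono
    rw [Submodule.span_le]
    rintro _ ⟨u, hu, rfl⟩
    rw [mem_coe, mem_filter] at hu
    have hmem : vcol (D + 2) u ∈ W := Submodule.subset_span ⟨u, hu.1, rfl⟩
    refine ⟨⟨_, hmem⟩, ?_, rfl⟩
    change sphT n m (vcol (D + 2) u) = 0
    rw [sphT_vcol, hu.2]
    simp

theorem hil_two (D : ℕ) (X : Finset (Fin 3 → ℤ)) :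
    (hil (D + 2) X : ℝ) * (1 - 6 / (D + 2)) ≤ hil D X := by
  have h1 := hil_shadow D X
  have h2 := hil_shadow (D + 1) X
  have h1' : ((D : ℝ) + 1) * hil (D + 1) X ≤ (D + 4) * hil D X := by exact_mod_cast h1
  have h2' : ((D : ℝ) + 2) * hil (D + 2) X ≤ (D + 5) * hil (D + 1) X := by
    have : ((D : ℝ) + 1 + 1) * hil (D + 1 + 1) X ≤ (D + 1 + 4) * hil (D + 1) X := by exact_mod_cast h2
    convert this using 2 <;> ring
  have hD : (0 : ℝ) ≤ D := Nat.cast_nonneg D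
  have ha : (0 : ℝ) ≤ hil (D + 2) X := Nat.cast_nonneg _
  have hb : (0 : ℝ) ≤ hil D X := Nat.cast_nonneg _
  have h3 : ((D : ℝ) + 1) * (D + 2) * hil (D + 2) X ≤ (D + 5) * (D + 4) * hil D X := by
    nlinarith
  have h4 : (1 : ℝ) - 6 / (D + 2) = (D - 4) / (D + 2) := by field_simp; ring
  rw [h4, mul_div_assoc', div_le_iff₀ (by positivity)]
  by_cases hD4 : (D : ℝ) ≤ 4
  · nlinarith
  · push Not at hD4
    have h5 : (0 : ℝ) < (D + 1) * (D + 2) := by positivity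
    have h6 : (hil (D + 2) X : ℝ) ≤ (D + 5) * (D + 4) * hil D X / ((D + 1) * (D + 2)) := by
      rw [le_div_iff₀ h5]; linarith
    have h7 : ((D : ℝ) - 4) * ((D + 5) * (D + 4)) ≤ (D + 2) * ((D + 1) * (D + 2)) := by nlinarith
    calc (hil (D + 2) X : ℝ) * (D - 4) ≤ (D + 5) * (D + 4) * hil D X / ((D + 1) * (D + 2)) * (D - 4) := by
          apply mul_le_mul_of_nonneg_right h6; linarith
      _ ≤ hil D X * (D + 2) := by
          rw [div_mul_eq_mul_div, div_le_iff₀ h5]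
          nlinarith

/-- incidence relation -/
def sph (m : ℕ) (n u : Fin 3 → ℤ) : Prop := ∑ i, (n i - u i) ^ 2 = (m : ℤ)

instance (m : ℕ) (n u : Fin 3 → ℤ) : Decidable (sph m n u) := by unfold sph; infer_instance

/-- neighbours -/
def nb (m : ℕ) (X : Finset (Fin 3 → ℤ)) (n : Fin 3 → ℤ) : Finset (Fin 3 → ℤ) := X.filter (sph m n)

/-- incidences -/
def Inc (m : ℕ) (X P : Finset (Fin 3 → ℤ)) : ℝ := ∑ n ∈ P, ((nb m X n).card : ℝ)

/-- codegree bound -/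
def codeg (m : ℕ) (P : Finset (Fin 3 → ℤ)) (t : ℝ) : Prop :=
  ∀ u u', u ≠ u' → ((P.filter (fun n => sph m n u ∧ sph m n u')).card : ℝ) ≤ t

theorem codeg.mono {m : ℕ} {P Q : Finset (Fin 3 → ℤ)} {t : ℝ} (h : codeg m P t) (hQ : Q ⊆ P) : codeg m Q t := by
  intro u u' hu
  refine le_trans ?_ (h u u' hu)
  exact_mod_cast card_le_card (filter_subset_filter _ hQ)

theorem sum_T (m : ℕ) (X P : Finset (Fin 3 → ℤ)) (t b : ℝ) (ht : 0 ≤ t) (hc : codeg m P t)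
    (K : (Fin 3 → ℤ) → (Fin 3 → ℤ) → ℝ) (hK : ∀ u ∈ X, K u u ^ 2 ≤ b) :
    ∑ n ∈ P, ∑ u ∈ nb m X n, ∑ u' ∈ nb m X n, K u u' ^ 2 ≤
      t * (∑ u ∈ X, ∑ u' ∈ X, K u u' ^ 2) + b * Inc m X P := by
  have h1 : ∀ n, ∑ u ∈ nb m X n, ∑ u' ∈ nb m X n, K u u' ^ 2 =
      ∑ u ∈ X, ∑ u' ∈ X, if (sph m n u ∧ sph m n u') then K u u' ^ 2 else 0 := by
    intro n
    simp only [nb, sum_filter]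
    apply sum_congr rfl; intro u _
    by_cases h : sph m n u <;> simp [h]
  have h2 : Inc m X P = ∑ u ∈ X, ((P.filter (fun n => sph m n u)).card : ℝ) := by
    simp only [Inc, nb, card_filter]
    push_cast
    rw [sum_comm]
  simp only [h1]
  rw [sum_comm, h2, mul_sum, mul_sum, ← sum_add_distrib]
  apply sum_le_sum
  intro u hu
  rw [sum_comm]
  have h3 : ∀ u' ∈ X, ∑ n ∈ P, (if (sph m n u ∧ sph m n u') then K u u' ^ 2 else 0) ≤
      t * K u u' ^ 2 + if u = u' then b * ((P.filter (fun n => sph m n u)).card : ℝ) else 0 := by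
    intro u' hu'
    rw [← sum_filter, sum_const, nsmul_eq_mul]
    split_ifs with h
    · subst h
      simp only [and_self]
      have h5 : (0:ℝ) ≤ ((P.filter (fun n => sph m n u)).card : ℝ) := Nat.cast_nonneg _
      have h6 := hK u hu
      have h7 : 0 ≤ t * K u u ^ 2 := by positivity
      nlinarith
    · rw [add_zero]
      exact mul_le_mul_of_nonneg_right (hc u u' h) (sq_nonneg _)
  refine (sum_le_sum h3).trans ?_
  rw [sum_add_distrib, ← mul_sum, sum_ite_eq, if_pos hu]

theorem quad_solve {x a b : ℝ} (ha : 0 ≤ a) (hb : 0 ≤ b) (h : x ^ 2 ≤ a + b * x) :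
    x ≤ Real.sqrt a + b := by
  by_contra hc
  push Not at hc
  have h1 := Real.sqrt_nonneg a
  have h2 := Real.sq_sqrt ha
  nlinarith

set_option maxHeartbeats 600000 in
theorem piece (m : ℕ) (D : ℕ) (X P : Finset (Fin 3 → ℤ)) (t : ℝ) (ht : 0 ≤ t) (hc : codeg m P t)
    (hX : X.Nonempty)
    (hmax : ∀ Y ⊆ X, (Y.card : ℝ) * hil (D + 2) X ≤ X.card * hil (D + 2) Y)
    (h64 : 64 * (hil (D + 2) X : ℝ) ≤ X.card) :
    Inc m X P ≤ 16 * t * X.card + 7 * X.card * Real.sqrt (t * P.card / (D + 2))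
      + 192 * P.card * hil (D + 2) X / (D + 2) := by
  classical
  set N : ℝ := ((hil (D + 2) X : ℕ) : ℝ) with hN
  set M : ℝ := ((X.card : ℕ) : ℝ) with hM
  have hM0 : 0 < M := by rw [hM]; exact_mod_cast hX.card_pos
  have hN0 : 0 < N := by rw [hN]; exact_mod_cast hil_pos _ hX
  set E : ℝ := (D : ℝ) + 2 with hE
  have hE0 : 0 < E := by positivity
  set p : ℝ := N / M with hp
  have hp0 : 0 < p := by positivity
  have hp64 : p ≤ 1 / 64 := by rw [hp, div_le_iff₀ hM0]; linarith
  have hpM : p * M = N := by rw [hp]; field_simp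
  obtain ⟨K, hK1, hK2, hK3⟩ := forster_kernel (vcol (D + 2)) X hX (hil (D + 2)) (fun Y => rfl)
    (hil_pos _ hX) p hpM (by
      intro Y hY
      have := hmax Y hY
      rw [hp, div_mul_eq_mul_div, div_le_iff₀ hM0]; linarith)
  set T : (Fin 3 → ℤ) → ℝ := fun n => ∑ u ∈ nb m X n, ∑ u' ∈ nb m X n, K u u' ^ 2 with hT
  have hT0 : ∀ n, 0 ≤ T n := fun n => sum_nonneg fun _ _ => sum_nonneg fun _ _ => sq_nonneg _
  have hsum : ∀ Q ⊆ P, ∑ n ∈ Q, T n ≤ t * N + 4 * p ^ 2 * Inc m X Q := by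
    intro Q hQ
    have := sum_T m X Q t (4 * p ^ 2) ht (hc.mono hQ) K (by
      intro u hu
      have := hK1 u hu
      nlinarith)
    rw [hK2] at this
    exact this
  set d : (Fin 3 → ℤ) → ℝ := fun n => ((nb m X n).card : ℝ) with hd
  have hd0 : ∀ n, 0 ≤ d n := fun n => Nat.cast_nonneg _
  have hdM : ∀ n, d n ≤ M := fun n => by
    simp only [hd, hM]; exact_mod_cast card_le_card (filter_subset _ _)
  have hsub : ∀ n, nb m X n ⊆ X := fun n => filter_subset _ _
  have hhil : ∀ n, (hil (D + 2) (nb m X n) : ℝ) ≤ N * (6 / E + d n / M) := by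
    intro n
    by_cases h6 : 1 ≤ 6 / E
    · have h1 : (hil (D + 2) (nb m X n) : ℝ) ≤ N := by
        rw [hN]; exact_mod_cast hil_mono _ (hsub n)
      have h2 : 0 ≤ d n / M := div_nonneg (hd0 n) hM0.le
      nlinarith
    · push Not at h6
      set Y := X.filter (fun u => ¬ sph m n u) with hY
      have h1 : (hil (D + 2) (nb m X n) : ℝ) + hil D Y ≤ N := by
        have := hil_split n m D X
        rw [hN]
        exact_mod_cast this
      have h2 := hil_two D Y
      have h3 := hmax Y (filter_subset _ _)
      have h4 : d n + Y.card = M := by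
        have := card_filter_add_card_filter_not (s := X) (sph m n)
        simp only [hd, hM, nb, hY]
        exact_mod_cast this
      have h5 : (Y.card : ℝ) = M - d n := by linarith
      rw [h5] at h3
      have h6' : N * (1 - d n / M) ≤ hil (D + 2) Y := by
        have : N * (1 - d n / M) = (M - d n) * N / M := by field_simp
        rw [this, div_le_iff₀ hM0]; linarith
      have h7 : N * (1 - d n / M) * (1 - 6 / E) ≤ hil (D + 2) Y * (1 - 6 / E) :=
        mul_le_mul_of_nonneg_right h6' (by linarith)
      have h8 : 0 ≤ N * (d n / M) * (6 / E) := by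
        have := hd0 n
        positivity
      nlinarith
  have hmain : ∀ n, (d n * (p / 2)) ^ 2 ≤ N * (6 / E + d n / M) * T n := by
    intro n
    have h1 := hK3 (nb m X n) (hsub n)
    have h2 : d n * (p / 2) ≤ ∑ u ∈ nb m X n, K u u := by
      have := card_nsmul_le_sum (nb m X n) (fun u => K u u) (p / 2) (fun u hu => (hK1 u (hsub n hu)).1)
      rwa [nsmul_eq_mul] at this
    have h3 : 0 ≤ d n * (p / 2) := mul_nonneg (hd0 n) (by positivity)
    calc (d n * (p / 2)) ^ 2 ≤ (∑ u ∈ nb m X n, K u u) ^ 2 := by gcongr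
      _ ≤ _ := h1
      _ ≤ _ := mul_le_mul_of_nonneg_right (hhil n) (hT0 n)
  set Q := P.filter (fun n => d n ≤ 6 * M / E) with hQ
  set R := P.filter (fun n => ¬ d n ≤ 6 * M / E) with hR
  have hsplit : Inc m X P = Inc m X Q + Inc m X R := (sum_filter_add_sum_filter_not P _ _).symm
  have hQ0 : 0 ≤ Inc m X Q := sum_nonneg fun n _ => hd0 n
  have hR0 : 0 ≤ Inc m X R := sum_nonneg fun n _ => hd0 n
  have hrich : Inc m X R ≤ 16 * t * M := by
    have h1 : ∀ n ∈ R, d n ≤ 8 / p * T n := by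
      intro n hn
      have hn2 := (mem_filter.mp hn).2
      push Not at hn2
      have hdn : 0 < d n := lt_of_le_of_lt (by positivity) hn2
      have h2 : 6 / E ≤ d n / M := by
        rw [le_div_iff₀ hM0]
        calc 6 / E * M = 6 * M / E := by ring
          _ ≤ _ := hn2.le
      have h3 : N * (6 / E + d n / M) ≤ 2 * p * d n := by
        have h31 : N * (d n / M) = p * d n := by rw [hp]; ring
        nlinarith
      have h4 := (hmain n).trans (mul_le_mul_of_nonneg_right h3 (hT0 n))
      have h5 : (p * d n) * (p * d n) ≤ (p * d n) * (8 * T n) := by nlinarith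
      have h6 : p * d n ≤ 8 * T n := le_of_mul_le_mul_left h5 (by positivity)
      rw [div_mul_eq_mul_div, le_div_iff₀ hp0]
      linarith
    have h2 : Inc m X R ≤ 8 / p * (t * N + 4 * p ^ 2 * Inc m X R) := by
      calc Inc m X R ≤ ∑ n ∈ R, 8 / p * T n := sum_le_sum h1
        _ = 8 / p * ∑ n ∈ R, T n := by rw [mul_sum]
        _ ≤ _ := mul_le_mul_of_nonneg_left (hsum R (filter_subset _ _)) (by positivity)
    have h3 : 8 / p * (t * N + 4 * p ^ 2 * Inc m X R) = 8 * t * M + 32 * p * Inc m X R := by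
      rw [← hpM]; field_simp; ring
    rw [h3] at h2
    nlinarith
  have hpoor : Inc m X Q ≤ 7 * M * Real.sqrt (t * P.card / E) + 192 * P.card * N / E := by
    have h1 : ∀ n ∈ Q, d n ^ 2 ≤ 48 * N / (E * p ^ 2) * T n := by
      intro n hn
      have hn2 := (mem_filter.mp hn).2
      have h2 : d n / M ≤ 6 / E := by
        rw [div_le_iff₀ hM0]
        calc d n ≤ 6 * M / E := hn2
          _ = _ := by ring
      have h3 : N * (6 / E + d n / M) ≤ 12 * N / E := by
        calc N * (6 / E + d n / M) ≤ N * (6 / E + 6 / E) := by gcongr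
          _ = _ := by ring
      have h4 := (hmain n).trans (mul_le_mul_of_nonneg_right h3 (hT0 n))
      rw [div_mul_eq_mul_div, le_div_iff₀ (by positivity)]
      rw [div_mul_eq_mul_div, le_div_iff₀ hE0] at h4
      nlinarith
    have hn0 : (0:ℝ) ≤ P.card := Nat.cast_nonneg _
    have h2 : (Inc m X Q) ^ 2 ≤ P.card * (48 * N / (E * p ^ 2) * (t * N + 4 * p ^ 2 * Inc m X Q)) := by
      calc (Inc m X Q) ^ 2 ≤ Q.card * ∑ n ∈ Q, d n ^ 2 := sq_sum_le_card_mul_sum_sq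
        _ ≤ P.card * ∑ n ∈ Q, d n ^ 2 := by
            refine mul_le_mul_of_nonneg_right ?_ (sum_nonneg fun _ _ => sq_nonneg _)
            exact_mod_cast card_le_card (filter_subset _ _)
        _ ≤ P.card * ∑ n ∈ Q, 48 * N / (E * p ^ 2) * T n :=
            mul_le_mul_of_nonneg_left (sum_le_sum h1) hn0
        _ ≤ _ := by
            rw [← mul_sum]
            refine mul_le_mul_of_nonneg_left (mul_le_mul_of_nonneg_left (hsum Q (filter_subset _ _)) ?_) hn0
            positivity
    have h3 : (P.card : ℝ) * (48 * N / (E * p ^ 2) * (t * N + 4 * p ^ 2 * Inc m X Q)) =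
        48 * M ^ 2 * (t * P.card / E) + (192 * P.card * N / E) * Inc m X Q := by
      rw [← hpM]; field_simp; ring
    rw [h3] at h2
    have h4 := quad_solve (by positivity) (by positivity) h2
    have h5 : Real.sqrt (48 * M ^ 2 * (t * P.card / E)) ≤ 7 * M * Real.sqrt (t * P.card / E) := by
      apply Real.sqrt_le_iff.mpr
      refine ⟨by positivity, ?_⟩
      rw [mul_pow, Real.sq_sqrt (by positivity), mul_pow]
      gcongr
      norm_num
    linarith
  rw [hsplit]; linarith

theorem Inc_nonneg (m : ℕ) (X P : Finset (Fin 3 → ℤ)) : 0 ≤ Inc m X P :=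
  sum_nonneg fun _ _ => Nat.cast_nonneg _

theorem Inc_le (m : ℕ) (X P : Finset (Fin 3 → ℤ)) : Inc m X P ≤ X.card * P.card := by
  have h : ∀ n ∈ P, ((nb m X n).card : ℝ) ≤ X.card := fun n _ => by
    exact_mod_cast card_le_card (filter_subset _ _)
  have := sum_le_card_nsmul P _ _ h
  rw [nsmul_eq_mul, mul_comm] at this
  exact this

theorem Inc_split (m : ℕ) (U X P : Finset (Fin 3 → ℤ)) (h : X ⊆ U) :
    Inc m U P = Inc m X P + Inc m (U \ X) P := by
  simp only [Inc]
  rw [← sum_add_distrib]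
  apply sum_congr rfl
  intro n _
  have : nb m U n = nb m X n ∪ nb m (U \ X) n := by
    simp only [nb]
    rw [← filter_union, union_sdiff_of_subset h]
  rw [this, card_union_of_disjoint]
  · push_cast; rfl
  · exact disjoint_filter_filter disjoint_sdiff

theorem removal (m D : ℕ) (P : Finset (Fin 3 → ℤ)) (t : ℝ) (ht : 0 ≤ t) (hc : codeg m P t)
    (κ : ℝ) (hκ : 64 ≤ κ) (U : Finset (Fin 3 → ℤ)) :
    ∃ U'' ⊆ U, (U''.card : ℝ) ≤ κ * (D + 3) ^ 3 ∧
      Inc m U P ≤ Inc m U'' P +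
        (16 * t + 7 * Real.sqrt (t * P.card / (D + 2)) + 192 * P.card / (κ * (D + 2))) * U.card := by
  induction U using Finset.strongInduction with
  | H U ih =>
    have hB0 : 0 ≤ 16 * t + 7 * Real.sqrt (t * P.card / (D + 2)) + 192 * P.card / (κ * (D + 2)) := by positivity
    set B := 16 * t + 7 * Real.sqrt (t * P.card / (D + 2)) + 192 * P.card / (κ * (D + 2)) with hB
    by_cases hU : (U.card : ℝ) ≤ κ * hil (D + 2) U
    · refine ⟨U, subset_rfl, hU.trans ?_, ?_⟩
      · have := hil_le (D + 2) U
        have h2 : (hil (D + 2) U : ℝ) ≤ (D + 3) ^ 3 := by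
          calc (hil (D + 2) U : ℝ) ≤ ((D + 2 + 1) ^ 3 : ℕ) := by exact_mod_cast this
            _ = _ := by push_cast; ring
        gcongr
      · have : 0 ≤ B * U.card := by positivity
        linarith
    · push Not at hU
      have hUne : U.Nonempty := by
        rw [← card_pos]
        by_contra h0
        have : U.card = 0 := by omega
        rw [this] at hU
        have : (0:ℝ) ≤ κ * hil (D + 2) U := by positivity
        simp at hU; linarith
      obtain ⟨X, hX, hXmax⟩ := exists_max_image (U.powerset.filter (fun X => X.Nonempty))
        (fun X => (X.card : ℝ) / hil (D + 2) X) ⟨U, by simp [hUne]⟩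
      rw [mem_filter, mem_powerset] at hX
      obtain ⟨hXU, hXne⟩ := hX
      have hhX : (0 : ℝ) < hil (D + 2) X := by exact_mod_cast hil_pos _ hXne
      have hhU : (0 : ℝ) < hil (D + 2) U := by exact_mod_cast hil_pos _ hUne
      have hκX : κ * hil (D + 2) X ≤ X.card := by
        have h1 := hXmax U (by simp [hUne])
        have h2 : κ ≤ (U.card : ℝ) / hil (D + 2) U := by rw [le_div_iff₀ hhU]; exact hU.le
        have h3 := h2.trans h1
        rwa [le_div_iff₀ hhX] at h3
      have hp := piece m D X P t ht hc hXne (by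
        intro Y hY
        by_cases hYne : Y.Nonempty
        · have h1 := hXmax Y (by simp [hYne, hY.trans hXU])
          have hhY : (0 : ℝ) < hil (D + 2) Y := by exact_mod_cast hil_pos _ hYne
          rw [div_le_div_iff₀ hhY hhX] at h1
          exact h1
        · rw [not_nonempty_iff_eq_empty] at hYne
          subst hYne
          simp only [card_empty, Nat.cast_zero, zero_mul]; positivity) (by nlinarith)
      have hpB : Inc m X P ≤ B * X.card := by
        have h1 : 192 * P.card * hil (D + 2) X / (D + 2) ≤ 192 * P.card / (κ * (D + 2)) * (X.card : ℝ) := by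
          have : (hil (D + 2) X : ℝ) ≤ X.card / κ := by
            rw [le_div_iff₀ (by linarith)]; linarith
          calc 192 * P.card * hil (D + 2) X / (D + 2) ≤ 192 * P.card * (X.card / κ) / ((D : ℝ) + 2) := by gcongr
            _ = _ := by field_simp
        rw [hB]; nlinarith
      obtain ⟨U'', h1, h2, h3⟩ := ih (U \ X) (sdiff_ssubset hXU hXne)
      refine ⟨U'', h1.trans sdiff_subset, h2, ?_⟩
      rw [Inc_split m U X P hXU]
      have h4 : (U.card : ℝ) = X.card + (U \ X).card := by
        have := card_sdiff_add_card_eq_card hXU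
        exact_mod_cast (by omega : U.card = X.card + (U \ X).card)
      rw [h4]
      nlinarith

theorem kst (m : ℕ) (U P : Finset (Fin 3 → ℤ)) (t : ℝ) (ht : 0 ≤ t) (hc : codeg m P t) :
    Inc m U P ^ 2 ≤ P.card * (t * U.card ^ 2) + P.card * Inc m U P := by
  have h := sum_T m U P t 1 ht hc (fun _ _ => 1) (by simp)
  simp only [one_pow, sum_const, nsmul_eq_mul, mul_one, one_mul] at h
  have h2 : Inc m U P ^ 2 ≤ P.card * ∑ n ∈ P, ((nb m U n).card : ℝ) ^ 2 := sq_sum_le_card_mul_sum_sq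
  have h3 : ∑ n ∈ P, ((nb m U n).card : ℝ) ^ 2 = ∑ n ∈ P, ((nb m U n).card : ℝ) * (nb m U n).card :=
    sum_congr rfl fun _ _ => sq _
  rw [h3] at h2
  calc Inc m U P ^ 2 ≤ _ := h2
    _ ≤ P.card * (t * ((U.card : ℝ) * U.card) + Inc m U P) := by gcongr
    _ = _ := by ring

/-- the main term -/
def Gm (M n : ℝ) : ℝ := (M ^ 4 * n ^ 3) ^ ((1 : ℝ) / 5)

theorem Gm_nonneg {M n : ℝ} (hn : 0 ≤ n) : 0 ≤ Gm M n := by unfold Gm; positivity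

theorem Gm_pow {M n : ℝ} (hn : 0 ≤ n) : Gm M n ^ 5 = M ^ 4 * n ^ 3 := by
  unfold Gm
  rw [← Real.rpow_natCast, ← Real.rpow_mul (by positivity)]
  norm_num

theorem Gm_mono {M M' n : ℝ} (hM : 0 ≤ M) (h : M ≤ M') (hn : 0 ≤ n) : Gm M n ≤ Gm M' n := by
  unfold Gm; gcongr

set_option maxHeartbeats 1000000 in
theorem halving (m : ℕ) (P : Finset (Fin 3 → ℤ)) (t : ℝ) (ht : 1 ≤ t) (hc : codeg m P t)
    (U : Finset (Fin 3 → ℤ)) :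
    ∃ U'' ⊆ U, 2 * U''.card ≤ U.card ∧
      Inc m U P ≤ Inc m U'' P + 30000 * t * (Gm U.card P.card + U.card + P.card) := by
  set M : ℝ := ((U.card : ℕ) : ℝ) with hM
  set n : ℝ := ((P.card : ℕ) : ℝ) with hn
  have hM0 : 0 ≤ M := by positivity
  have hn0 : 0 ≤ n := by positivity
  have hG0 : 0 ≤ Gm M n := Gm_nonneg hn0
  have hG5 := Gm_pow (M := M) hn0
  have hs1 : 1 ≤ Real.sqrt t := Real.one_le_sqrt.mpr ht
  have hst : Real.sqrt t ≤ t := by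
    have := Real.sq_sqrt (by linarith : 0 ≤ t)
    nlinarith
  have triv : Inc m U P ≤ 30000 * t * (Gm M n + M + n) → ∃ U'' ⊆ U, 2 * U''.card ≤ U.card ∧
      Inc m U P ≤ Inc m U'' P + 30000 * t * (Gm M n + M + n) := by
    intro h
    exact ⟨∅, empty_subset _, by simp, by have := Inc_nonneg m ∅ P; linarith⟩
  have hGM : 0 ≤ t * Gm M n := by positivity
  have htM : 0 ≤ t * M := by positivity
  have htn : 0 ≤ t * n := by positivity
  by_cases hc1 : U.card < 4096
  · apply triv
    have h1 := Inc_le m U P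
    have h2 : M ≤ 4096 := by rw [hM]; exact_mod_cast hc1.le
    nlinarith
  by_cases hc2 : U.card ^ 2 < 32 * P.card
  · apply triv
    have h1 := kst m U P t (by linarith) hc
    have h2 := quad_solve (by positivity) (by positivity) h1
    have h3 : M ^ 2 ≤ 32 * n := by rw [hM, hn]; exact_mod_cast hc2.le
    have h4 : Real.sqrt (n * (t * M ^ 2)) ≤ 6 * (t * n) := by
      apply Real.sqrt_le_iff.mpr
      refine ⟨by positivity, ?_⟩
      calc n * (t * M ^ 2) ≤ n * (t * (32 * n)) := by gcongr
        _ = 32 * n ^ 2 * (t * 1) := by ring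
        _ ≤ 32 * n ^ 2 * (t * t) := by gcongr
        _ ≤ _ := by nlinarith [sq_nonneg (t * n)]
    nlinarith
  push Not at hc1 hc2
  let Pr : ℕ → Prop := fun E => E ^ 5 * P.card ≤ U.card ^ 2 ∧ 512 * E ^ 3 ≤ U.card
  have hPr2 : Pr 2 := ⟨by omega, by omega⟩
  classical
  set E := Nat.findGreatest Pr U.card with hE
  have hE2 : 2 ≤ E := Nat.le_findGreatest (by omega) hPr2
  have hEP : Pr E := Nat.findGreatest_spec (by omega : 2 ≤ U.card) hPr2
  have hEn : ¬ Pr (E + 1) := by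
    intro h
    have h1 : E + 1 ≤ U.card := by
      have h2 := h.2
      have h3 : (E + 1) ≤ (E + 1) ^ 3 := Nat.le_self_pow (by norm_num) _
      omega
    have := Nat.le_findGreatest h1 h
    omega
  obtain ⟨D, hD⟩ : ∃ D, E = D + 2 := ⟨E - 2, by omega⟩
  set x : ℝ := (D : ℝ) + 2 with hx
  have hxE : (E : ℝ) = x := by rw [hD, hx]; push_cast; ring
  have hx2 : 2 ≤ x := by rw [← hxE]; exact_mod_cast hE2
  have ha : x ^ 5 * n ≤ M ^ 2 := by rw [← hxE, hM, hn]; exact_mod_cast hEP.1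
  have hb : 512 * x ^ 3 ≤ M := by rw [← hxE, hM]; exact_mod_cast hEP.2
  have hor : M ^ 2 < (x + 1) ^ 5 * n ∨ M < 512 * (x + 1) ^ 3 := by
    by_contra hcon
    push Not at hcon
    apply hEn
    rw [← hxE, hM, hn] at hcon
    exact ⟨by exact_mod_cast hcon.1, by exact_mod_cast hcon.2⟩
  have hx1 : x + 1 ≤ 2 * x := by linarith
  have hx0 : 0 < x := by linarith
  have hMp : 0 < M := by
    have : (0:ℝ) < x ^ 3 := by positivity
    linarith
  have hnE : n * x ^ 2 ≤ Gm M n := by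
    apply le_of_pow_le_pow_left₀ (n := 5) (by norm_num) hG0
    rw [hG5]
    calc (n * x ^ 2) ^ 5 = n ^ 3 * (x ^ 5 * n) ^ 2 := by ring
      _ ≤ n ^ 3 * (M ^ 2) ^ 2 := by gcongr
      _ = _ := by ring
  have hsq : M * Real.sqrt (n / x) ≤ 6 * Gm M n + 4096 * M := by
    rcases hor with h | h
    · have h1 : M ^ 2 ≤ 32 * x ^ 5 * n := by
        calc M ^ 2 ≤ (x + 1) ^ 5 * n := h.le
          _ ≤ (2 * x) ^ 5 * n := by gcongr
          _ = _ := by ring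
      have h2 : M * Real.sqrt (n / x) ≤ 6 * Gm M n := by
        apply le_of_pow_le_pow_left₀ (n := 10) (by norm_num) (by positivity)
        have h3 : (M * Real.sqrt (n / x)) ^ 10 = M ^ 10 * (n / x) ^ 5 := by
          rw [mul_pow, show (10:ℕ) = 2 * 5 from rfl, pow_mul (Real.sqrt _), Real.sq_sqrt (by positivity)]
        have h4 : (6 * Gm M n) ^ 10 = 6 ^ 10 * (M ^ 4 * n ^ 3) ^ 2 := by
          rw [← hG5]; ring
        rw [h3, h4, div_pow, mul_div_assoc', div_le_iff₀ (by positivity)]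
        calc M ^ 10 * n ^ 5 = M ^ 8 * n ^ 5 * M ^ 2 := by ring
          _ ≤ M ^ 8 * n ^ 5 * (32 * x ^ 5 * n) := by gcongr
          _ = 32 * (M ^ 8 * n ^ 6 * x ^ 5) := by ring
          _ ≤ 6 ^ 10 * (M ^ 8 * n ^ 6 * x ^ 5) := by gcongr; norm_num
          _ = _ := by ring
      linarith
    · have h1 : M ≤ 4096 * x ^ 3 := by
        calc M ≤ 512 * (x + 1) ^ 3 := h.le
          _ ≤ 512 * (2 * x) ^ 3 := by gcongr
          _ = _ := by ring
      have h2 : n ≤ 4096 ^ 2 * x := by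
        have h3 : x ^ 5 * n ≤ x ^ 5 * (4096 ^ 2 * x) := by
          calc x ^ 5 * n ≤ M ^ 2 := ha
            _ ≤ (4096 * x ^ 3) ^ 2 := by gcongr
            _ = _ := by ring
        exact le_of_mul_le_mul_left h3 (by positivity)
      have h3 : Real.sqrt (n / x) ≤ 4096 := by
        apply Real.sqrt_le_iff.mpr
        refine ⟨by norm_num, ?_⟩
        rw [div_le_iff₀ hx0]; exact h2
      nlinarith
  set κ : ℝ := M / (2 * (D + 3) ^ 3) with hκ
  have hD3 : ((D : ℝ) + 3) ^ 3 ≤ 4 * x ^ 3 := by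
    have h1 : (D : ℝ) + 3 ≤ 3 / 2 * x := by rw [hx]; rw [hx] at hx2; linarith
    calc ((D : ℝ) + 3) ^ 3 ≤ (3 / 2 * x) ^ 3 := by gcongr
      _ = 27 / 8 * x ^ 3 := by ring
      _ ≤ _ := by gcongr; norm_num
  have hDp : (0:ℝ) < ((D : ℝ) + 3) ^ 3 := by positivity
  have hκ64 : 64 ≤ κ := by
    rw [hκ, le_div_iff₀ (by positivity)]
    linarith
  obtain ⟨U'', h1, h2, h3⟩ := removal m D P t (by linarith) hc κ hκ64 U
  refine ⟨U'', h1, ?_, ?_⟩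
  · have : κ * ((D : ℝ) + 3) ^ 3 = M / 2 := by rw [hκ]; field_simp
    rw [this] at h2
    have h4 : 2 * (U''.card : ℝ) ≤ M := by linarith
    rw [hM] at h4
    exact_mod_cast h4
  · refine h3.trans ?_
    have h4 : 192 * n / (κ * (D + 2)) * M ≤ 1536 * Gm M n := by
      calc 192 * n / (κ * (D + 2)) * M = 384 * n * ((D : ℝ) + 3) ^ 3 / x := by
            rw [hκ, ← hx]; field_simp; ring
        _ ≤ 384 * n * (4 * x ^ 3) / x := by gcongr
        _ = 1536 * (n * x ^ 2) := by field_simp; ring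
        _ ≤ _ := by gcongr
    have h5 : Real.sqrt (t * n / (D + 2)) * M ≤ t * (6 * Gm M n + 4096 * M) := by
      rw [← hx, mul_div_assoc, Real.sqrt_mul (by linarith)]
      calc Real.sqrt t * Real.sqrt (n / x) * M = Real.sqrt t * (M * Real.sqrt (n / x)) := by ring
        _ ≤ t * (6 * Gm M n + 4096 * M) := by gcongr
    have h6 : Gm M n ≤ t * Gm M n := by nlinarith
    nlinarith

theorem incidence (m : ℕ) (P : Finset (Fin 3 → ℤ)) (t : ℝ) (ht : 1 ≤ t) (hc : codeg m P t)
    (U : Finset (Fin 3 → ℤ)) :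
    Inc m U P ≤ (Nat.log 2 U.card + 1 : ℕ) * (30000 * t * (Gm U.card P.card + U.card + P.card)) := by
  have key : ∀ k : ℕ, ∀ V : Finset (Fin 3 → ℤ), V.card < 2 ^ k → V.card ≤ U.card →
      Inc m V P ≤ k * (30000 * t * (Gm U.card P.card + U.card + P.card)) := by
    intro k
    induction k with
    | zero =>
      intro V hV _
      have : V = ∅ := by rw [← card_eq_zero]; omega
      subst this
      simp [Inc, nb]
    | succ k ih =>
      intro V hV hVU
      obtain ⟨V', h1, h2, h3⟩ := halving m P t ht hc V
      have h4 := ih V' (by rw [pow_succ] at hV; omega) (by omega)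
      have h5 : Gm V.card P.card ≤ Gm U.card P.card :=
        Gm_mono (Nat.cast_nonneg _) (by exact_mod_cast hVU) (Nat.cast_nonneg _)
      have h6 : (V.card : ℝ) ≤ U.card := by exact_mod_cast hVU
      have h7 : 30000 * t * (Gm V.card P.card + V.card + P.card) ≤ 30000 * t * (Gm U.card P.card + U.card + P.card) := by
        gcongr
      push_cast
      linarith
  exact key _ U (Nat.lt_pow_succ_log_self (by norm_num) _) le_rfl

abbrev V3 := Fin 3 → ℤ

/-- tuples -/
def tup (s : ℕ) (A : Finset V3) : Finset (Fin s → V3) := Fintype.piFinset (fun _ => A)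

/-- representation count -/
def rr (s : ℕ) (A : Finset V3) (n : V3) : ℕ := ((tup s A).filter (fun x => ∑ i, x i = n)).card

/-- sumset -/
def SS (s : ℕ) (A : Finset V3) : Finset V3 := (tup s A).image (fun x => ∑ i, x i)

/-- energy -/
def En (s : ℕ) (A : Finset V3) : ℕ := ∑ n ∈ SS s A, rr s A n ^ 2

theorem tup_card (s : ℕ) (A : Finset V3) : (tup s A).card = A.card ^ s := by
  simp [tup]

theorem rr_sum (s : ℕ) (A : Finset V3) : ∑ n ∈ SS s A, rr s A n = A.card ^ s := by
  rw [← tup_card, card_eq_sum_card_fiberwise (f := fun x => ∑ i, x i) (t := SS s A)]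
  · rfl
  · intro x hx
    exact mem_image_of_mem _ hx

theorem rr_le (s : ℕ) (A : Finset V3) (n : V3) : rr s A n ≤ A.card ^ s := by
  rw [← tup_card]; exact card_le_card (filter_subset _ _)

theorem rr_mem {s : ℕ} {A : Finset V3} {n : V3} (h : rr s A n ≠ 0) : n ∈ SS s A := by
  obtain ⟨x, hx⟩ := card_pos.mp (Nat.pos_of_ne_zero h)
  rw [mem_filter] at hx
  exact mem_image.mpr ⟨x, hx.1, hx.2⟩

theorem rr_pos {s : ℕ} {A : Finset V3} {n : V3} (h : n ∈ SS s A) : 0 < rr s A n := by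
  obtain ⟨x, hx, h2⟩ := mem_image.mp h
  exact card_pos.mpr ⟨x, mem_filter.mpr ⟨hx, h2⟩⟩

theorem SS_card (s : ℕ) (A : Finset V3) : (SS s A).card ≤ A.card ^ s := by
  rw [← tup_card]; exact card_image_le

theorem rr_succ (s : ℕ) (A : Finset V3) (n : V3) : rr (s + 1) A n = ∑ a ∈ A, rr s A (n - a) := by
  unfold rr
  rw [card_eq_sum_card_fiberwise (f := fun x : Fin (s + 1) → V3 => x 0) (t := A)]
  · apply sum_congr rfl
    intro a ha
    refine card_bij' (fun x _ => Fin.tail x) (fun y _ => Fin.cons a y) ?_ ?_ ?_ ?_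
    · intro x hx
      simp only [mem_filter, tup, Fintype.mem_piFinset, Fin.sum_univ_succ] at hx ⊢
      obtain ⟨⟨h1, h2⟩, h3⟩ := hx
      refine ⟨fun i => h1 _, ?_⟩
      rw [← h2, h3]
      simp [Fin.tail]
    · intro y hy
      simp only [mem_filter, tup, Fintype.mem_piFinset, Fin.sum_univ_succ, Fin.cons_zero, Fin.cons_succ] at hy ⊢
      refine ⟨⟨fun i => ?_, ?_⟩, trivial⟩
      · refine Fin.cases ?_ ?_ i
        · simpa using ha
        · intro j; simpa using hy.1 j
      · rw [hy.2]; abel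
    · intro x hx
      rw [mem_filter] at hx
      rw [← hx.2]; exact Fin.cons_self_tail x
    · intro y hy
      simp
  · intro x hx
    simp only [coe_filter, Set.mem_ofPred_eq, tup, Fintype.mem_piFinset] at hx
    exact hx.1 0

theorem rr_succ' (s : ℕ) (A : Finset V3) (n : V3) :
    rr (s + 1) A n = ∑ u ∈ SS s A, if n - u ∈ A then rr s A u else 0 := by
  rw [rr_succ, ← sum_filter]
  have h1 : ∑ a ∈ A, rr s A (n - a) = ∑ u ∈ A.image (fun a => n - a), rr s A u := by
    rw [sum_image]
    intro a _ b _ h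
    exact sub_right_injective h
  rw [h1]
  symm
  apply sum_subset_zero_on_sdiff
  · intro u hu
    rw [mem_filter] at hu
    exact mem_image.mpr ⟨n - u, hu.2, by abel⟩
  · intro u hu
    rw [mem_sdiff, mem_image, mem_filter] at hu
    obtain ⟨⟨a, ha, rfl⟩, h2⟩ := hu
    by_contra h3
    apply h2
    refine ⟨rr_mem h3, ?_⟩
    simpa using ha
  · intro _ _; rfl

theorem rr_zero (A : Finset V3) (n : V3) : rr 0 A n = if n = 0 then 1 else 0 := by
  unfold rr tup
  split_ifs with h
  · subst h; simp
  · rw [card_eq_zero, filter_eq_empty_iff]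
    intro x _ h2
    apply h; rw [← h2]; simp

theorem rr_one (A : Finset V3) (n : V3) : rr 1 A n = if n ∈ A then 1 else 0 := by
  rw [rr_succ]
  simp only [rr_zero, sub_eq_zero]
  simp

theorem rr_two (A : Finset V3) (n : V3) : rr 2 A n = (A.filter (fun a => n - a ∈ A)).card := by
  rw [rr_succ, card_filter]
  simp only [rr_one]

theorem addEnergy_eq (s : ℕ) (A : Finset V3) : addEnergy s (A : Set V3) = En s A := by
  unfold _root_.addEnergy
  have h1 : Nat.card {p : (Fin s → V3) × (Fin s → V3) //
    (∀ i, p.1 i ∈ (A : Set V3)) ∧ (∀ i, p.2 i ∈ (A : Set V3)) ∧ ∑ i, p.1 i = ∑ i, p.2 i} =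
      (((tup s A) ×ˢ (tup s A)).filter (fun p => ∑ i, p.1 i = ∑ i, p.2 i)).card := by
    apply Nat.subtype_card
    intro p
    simp [tup, and_assoc]
  rw [h1, card_filter, sum_product_right]
  have h2 : ∀ y : Fin s → V3, ∑ x ∈ tup s A, (if ∑ i, x i = ∑ i, y i then 1 else 0) = rr s A (∑ i, y i) := by
    intro y
    rw [rr, card_filter]
  simp only [h2]
  rw [← sum_fiberwise_of_maps_to (g := fun x : Fin s → V3 => ∑ i, x i) (t := SS s A)
    (fun x hx => mem_image_of_mem _ hx)]
  unfold En
  apply sum_congr rfl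
  intro n _
  rw [sum_congr rfl (g := fun _ => rr s A n)]
  · rw [sum_const, smul_eq_mul, sq]; rfl
  · intro x hx; rw [(mem_filter.mp hx).2]

/-- A lies on the sphere -/
def onS (m : ℕ) (A : Finset V3) : Prop := ∀ a ∈ A, ∑ i, a i ^ 2 = (m : ℤ)

/-- circle bound with constant t -/
def circ (m : ℕ) (t : ℝ) : Prop := ∀ u u' : Fin 3 → ℤ, u ≠ u' → ∀ S : Finset (Fin 3 → ℤ),
  (∀ n ∈ S, ∑ i, (n i - u i) ^ 2 = (m : ℤ) ∧ ∑ i, (n i - u' i) ^ 2 = (m : ℤ)) → (S.card : ℝ) ≤ t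

theorem circ.codeg {m : ℕ} {t : ℝ} (h : circ m t) (P : Finset V3) : codeg m P t := by
  intro u u' hu
  apply h u u' hu
  intro n hn
  rw [mem_filter] at hn
  exact hn.2

theorem rr_two_le {m : ℕ} {t : ℝ} (h : circ m t) {A : Finset V3} (hA : onS m A) (n : V3) (hn : n ≠ 0) :
    (rr 2 A n : ℝ) ≤ t := by
  rw [rr_two]
  apply h 0 n hn.symm
  intro a ha
  rw [mem_filter] at ha
  refine ⟨by simpa using hA a ha.1, ?_⟩
  have := hA _ ha.2
  rw [← this]
  apply sum_congr rfl
  intro i _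
  simp only [Pi.sub_apply]; ring

theorem rr_two_le' (A : Finset V3) (n : V3) : rr 2 A n ≤ A.card := by
  rw [rr_two]; exact card_le_card (filter_subset _ _)

theorem En_two {m : ℕ} {t : ℝ} (ht : 1 ≤ t) (h : circ m t) {A : Finset V3} (hA : onS m A) :
    (En 2 A : ℝ) ≤ 2 * t * (A.card : ℝ) ^ 2 := by
  unfold En
  push_cast
  have h1 : ∀ n ∈ SS 2 A, (rr 2 A n : ℝ) ^ 2 ≤ t * rr 2 A n + if n = 0 then (A.card : ℝ) ^ 2 else 0 := by
    intro n _
    have h0 : (0 : ℝ) ≤ rr 2 A n := Nat.cast_nonneg _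
    split_ifs with hn
    · have : (rr 2 A n : ℝ) ≤ A.card := by exact_mod_cast rr_two_le' A n
      nlinarith
    · have := rr_two_le h hA n hn
      nlinarith
  refine (sum_le_sum h1).trans ?_
  rw [sum_add_distrib, ← mul_sum]
  have h2 : (∑ n ∈ SS 2 A, (rr 2 A n : ℝ)) = (A.card : ℝ) ^ 2 := by exact_mod_cast rr_sum 2 A
  rw [h2, sum_ite_eq']
  have : (0:ℝ) ≤ (A.card : ℝ) ^ 2 := by positivity
  split_ifs <;> nlinarith

theorem rr_bound {m : ℕ} {t : ℝ} (ht : 1 ≤ t) (h : circ m t) {A : Finset V3} (hA : onS m A) (k : ℕ) (n : V3) :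
    (rr (k + 3) A n : ℝ) ≤ 2 * t * (A.card : ℝ) ^ (k + 1) := by
  induction k generalizing n with
  | zero =>
    rw [rr_succ]
    push_cast
    have h1 : ∀ a ∈ A, (rr (0 + 2) A (n - a) : ℝ) ≤ t + if n = a then (A.card : ℝ) else 0 := by
      intro a _
      split_ifs with hn
      · have : (rr 2 A (n - a) : ℝ) ≤ A.card := by exact_mod_cast rr_two_le' A _
        simp only [zero_add]; linarith
      · have := rr_two_le h hA (n - a) (sub_ne_zero.mpr hn)
        simpa using this
    refine (sum_le_sum h1).trans ?_
    rw [sum_add_distrib, sum_const, nsmul_eq_mul, sum_ite_eq]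
    have : (0:ℝ) ≤ (A.card : ℝ) := by positivity
    simp only [pow_one]
    split_ifs <;> nlinarith
  | succ k ih =>
    rw [rr_succ]
    push_cast
    have := sum_le_card_nsmul A (fun a => (rr (k + 1 + 2) A (n - a) : ℝ)) _ (fun a _ => ih (n - a))
    refine this.trans (le_of_eq ?_)
    rw [nsmul_eq_mul]; ring

/-- incidences through differences in A -/
def IA (A U P : Finset V3) : ℝ := ∑ n ∈ P, ((U.filter (fun u => n - u ∈ A)).card : ℝ)

theorem IA_le_Inc {m : ℕ} {A : Finset V3} (hA : onS m A) (U P : Finset V3) : IA A U P ≤ Inc m U P := by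
  apply sum_le_sum
  intro n _
  have : U.filter (fun u => n - u ∈ A) ⊆ nb m U n := by
    intro u hu
    rw [mem_filter] at hu
    rw [nb, mem_filter]
    exact ⟨hu.1, hA _ hu.2⟩
  exact_mod_cast card_le_card this

theorem IA_le (A U P : Finset V3) : IA A U P ≤ U.card * A.card := by
  have h1 : IA A U P = ∑ u ∈ U, ((P.filter (fun n => n - u ∈ A)).card : ℝ) := by
    simp only [IA, card_filter]
    push_cast
    rw [sum_comm]
  rw [h1]
  have h2 : ∀ u ∈ U, ((P.filter (fun n => n - u ∈ A)).card : ℝ) ≤ A.card := by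
    intro u _
    have : (P.filter (fun n => n - u ∈ A)).card ≤ A.card := by
      apply card_le_card_of_injOn (fun n => n - u)
      · intro n hn
        rw [mem_coe, mem_filter] at hn
        exact hn.2
      · intro a _ b _ h
        exact sub_left_injective h
    exact_mod_cast this
  have := sum_le_card_nsmul U _ _ h2
  rwa [nsmul_eq_mul] at this

theorem level_real (k : ℕ) (n M N ρ τ E' L H t I : ℝ) (hn : 0 < n) (hM : 0 ≤ M) (hN : 1 ≤ N) (hρ : 0 < ρ)
    (hτ : 0 < τ) (hL : 1 ≤ L) (hH : 1 ≤ H) (ht : 1 ≤ t) (hE : 0 ≤ E')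
    (h1 : I ≤ H * (Gm M n + M + n)) (h2 : I ≤ M * N) (h3 : τ * n ≤ L * (2 * ρ * I))
    (h4 : ρ * M ≤ N ^ (k + 2)) (h5 : ρ ^ 2 * M ≤ E') (h6 : τ * n ≤ N ^ (k + 3)) (h7 : τ ≤ 2 * t * N ^ (k + 1)) :
    n * τ ^ 2 ≤ 2 * t * (6 * L * H) ^ 2 *
      ((E' * N ^ (4 * k + 9)) ^ ((1 : ℝ) / 3) + N ^ (2 * k + 3) + N * E') := by
  set c := 6 * L * H with hc
  have hLH : 1 ≤ L * H := one_le_mul_of_one_le_of_one_le hL hH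
  have hc1 : 1 ≤ c := by rw [hc]; nlinarith
  have hc6 : c = 6 * (L * H) := by rw [hc]; ring
  have hLc : 6 * L ≤ c := by rw [hc]; nlinarith
  set Z := (E' * N ^ (4 * k + 9)) ^ ((1 : ℝ) / 3) with hZ
  have hN0 : 0 < N := by linarith
  have hZ0 : 0 ≤ Z := by positivity
  have hZ3 : Z ^ 3 = E' * N ^ (4 * k + 9) := by
    rw [hZ, ← Real.rpow_natCast, ← Real.rpow_mul (by positivity)]
    norm_num
  have hG0 : 0 ≤ Gm M n := Gm_nonneg hn.le
  have hW : c ^ 2 ≤ 2 * t * c ^ 2 := by nlinarith [sq_nonneg c]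
  have hX2 : 0 ≤ N ^ (2 * k + 3) := by positivity
  have hX3 : 0 ≤ N * E' := by positivity
  have hW0 : 0 ≤ 2 * t * c ^ 2 := by positivity
  have hmain : τ * n ≤ 2 * (L * H) * ρ * (Gm M n + M + n) := by
    calc τ * n ≤ L * (2 * ρ * I) := h3
      _ ≤ L * (2 * ρ * (H * (Gm M n + M + n))) := by gcongr
      _ = _ := by ring
  have hLH0 : 0 ≤ L * H := by linarith
  have hcase : τ * n ≤ c * ρ * Gm M n ∨ τ * n ≤ c * ρ * M ∨ τ * n ≤ c * ρ * n := by
    have haa : 0 ≤ 2 * (L * H) * ρ := by positivity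
    by_contra hcon
    push Not at hcon
    rw [hc6] at hcon
    nlinarith [hcon.1, hcon.2.1, hcon.2.2]
  rcases hcase with h | h | h
  · have hG5 := Gm_pow (M := M) hn.le
    have h8 : (τ * n) ^ 5 ≤ c ^ 5 * ρ ^ 5 * (M ^ 4 * n ^ 3) := by
      calc (τ * n) ^ 5 ≤ (c * ρ * Gm M n) ^ 5 := by gcongr
        _ = _ := by rw [← hG5]; ring
    have h9 : τ ^ 5 * n ^ 2 ≤ c ^ 5 * ((ρ ^ 2 * M) * (ρ * M) ^ 3) := by
      have : n ^ 3 * (τ ^ 5 * n ^ 2) ≤ n ^ 3 * (c ^ 5 * ((ρ ^ 2 * M) * (ρ * M) ^ 3)) := by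
        calc n ^ 3 * (τ ^ 5 * n ^ 2) = (τ * n) ^ 5 := by ring
          _ ≤ _ := h8
          _ = _ := by ring
      exact le_of_mul_le_mul_left this (by positivity)
    have h10 : τ ^ 5 * n ^ 2 ≤ c ^ 5 * (E' * (N ^ (k + 2)) ^ 3) := by
      refine h9.trans ?_
      gcongr
    have h11 : (n * τ ^ 2) ^ 3 ≤ (c ^ 2 * Z) ^ 3 := by
      calc (n * τ ^ 2) ^ 3 = (τ ^ 5 * n ^ 2) * (τ * n) := by ring
        _ ≤ (c ^ 5 * (E' * (N ^ (k + 2)) ^ 3)) * N ^ (k + 3) := by gcongr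
        _ = c ^ 5 * Z ^ 3 := by rw [hZ3]; ring
        _ ≤ c ^ 6 * Z ^ 3 := by gcongr; norm_num
        _ = _ := by ring
    have h12 : n * τ ^ 2 ≤ c ^ 2 * Z := le_of_pow_le_pow_left₀ (by norm_num) (by positivity) h11
    calc n * τ ^ 2 ≤ c ^ 2 * Z := h12
      _ ≤ 2 * t * c ^ 2 * Z := by gcongr
      _ ≤ _ := by
        apply mul_le_mul_of_nonneg_left _ hW0
        linarith
  · have h8 : n * τ ^ 2 ≤ c * N ^ (k + 2) * (2 * t * N ^ (k + 1)) := by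
      calc n * τ ^ 2 = (τ * n) * τ := by ring
        _ ≤ (c * ρ * M) * (2 * t * N ^ (k + 1)) := by gcongr
        _ = c * (ρ * M) * (2 * t * N ^ (k + 1)) := by ring
        _ ≤ _ := by gcongr
    calc n * τ ^ 2 ≤ _ := h8
      _ = 2 * t * (c * 1) * N ^ (2 * k + 3) := by ring
      _ ≤ 2 * t * (c * c) * N ^ (2 * k + 3) := by gcongr
      _ = 2 * t * c ^ 2 * N ^ (2 * k + 3) := by ring
      _ ≤ _ := by
        apply mul_le_mul_of_nonneg_left _ hW0
        linarith
  · have h8 : τ ≤ c * ρ := le_of_mul_le_mul_right h hn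
    calc n * τ ^ 2 = τ * (τ * n) := by ring
      _ ≤ (c * ρ) * (L * (2 * ρ * (M * N))) := by
          have h9 : τ * n ≤ L * (2 * ρ * (M * N)) := h3.trans (by gcongr)
          exact mul_le_mul h8 h9 (by positivity) (by positivity)
      _ = c * (2 * L) * (N * (ρ ^ 2 * M)) := by ring
      _ ≤ c * c * (N * E') := by
          gcongr
          linarith
      _ = c ^ 2 * (N * E') := by ring
      _ ≤ 2 * t * c ^ 2 * (N * E') := by gcongr
      _ ≤ _ := by
        apply mul_le_mul_of_nonneg_left _ hW0
        linarith

theorem log_level {r : ℕ} (h : 0 < r) : (2 : ℝ) ^ Nat.log 2 r ≤ r ∧ (r : ℝ) ≤ 2 * 2 ^ Nat.log 2 r := by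
  constructor
  · exact_mod_cast Nat.pow_log_le_self 2 h.ne'
  · have := (Nat.lt_pow_succ_log_self (by norm_num : 1 < 2) r).le
    rw [pow_succ] at this
    have h2 : (r : ℝ) ≤ 2 ^ Nat.log 2 r * 2 := by exact_mod_cast this
    linarith

theorem energy_step (k m : ℕ) (t : ℝ) (ht : 1 ≤ t) (h : circ m t) (A : Finset V3) (hA : onS m A)
    (hne : A.Nonempty) (L : ℝ) (hL : L = (Nat.log 2 (A.card ^ (k + 3)) + 1 : ℕ)) :
    (En (k + 3) A : ℝ) ≤ L * (4 * (2 * t * (6 * L * (30000 * t * L)) ^ 2 *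
      (((En (k + 2) A : ℝ) * (A.card : ℝ) ^ (4 * k + 9)) ^ ((1 : ℝ) / 3) + (A.card : ℝ) ^ (2 * k + 3) +
        A.card * En (k + 2) A))) := by
  set ℓ := Nat.log 2 (A.card ^ (k + 3)) + 1 with hℓ
  have hcard : 1 ≤ A.card := hne.card_pos
  have hN1 : (1 : ℝ) ≤ A.card := by exact_mod_cast hcard
  have hL1 : 1 ≤ L := by rw [hL]; exact_mod_cast (by omega : 1 ≤ ℓ)
  set B := 2 * t * (6 * L * (30000 * t * L)) ^ 2 *
      (((En (k + 2) A : ℝ) * (A.card : ℝ) ^ (4 * k + 9)) ^ ((1 : ℝ) / 3) + (A.card : ℝ) ^ (2 * k + 3) +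
        A.card * En (k + 2) A) with hB
  have hB0 : 0 ≤ B := by positivity
  have hpow : A.card ^ (k + 2) ≤ A.card ^ (k + 3) := Nat.pow_le_pow_right hcard (by omega)
  let P : ℕ → Finset V3 := fun j => (SS (k + 3) A).filter (fun n => Nat.log 2 (rr (k + 3) A n) = j)
  let U : ℕ → Finset V3 := fun j => (SS (k + 2) A).filter (fun n => Nat.log 2 (rr (k + 2) A n) = j)
  have hsumr : (∑ n ∈ SS (k + 3) A, (rr (k + 3) A n : ℝ)) = (A.card : ℝ) ^ (k + 3) := by
    exact_mod_cast rr_sum (k + 3) A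
  have hsumr2 : (∑ n ∈ SS (k + 2) A, (rr (k + 2) A n : ℝ)) = (A.card : ℝ) ^ (k + 2) := by
    exact_mod_cast rr_sum (k + 2) A
  have hlev : ∀ j, ((P j).card : ℝ) * (2 ^ j) ^ 2 ≤ B := by
    intro j
    by_cases hPe : (P j).Nonempty
    swap
    · rw [not_nonempty_iff_eq_empty] at hPe
      rw [hPe]; simpa using hB0
    have hPr : ∀ n ∈ P j, (2:ℝ) ^ j ≤ rr (k + 3) A n := by
      intro n hn
      rw [mem_filter] at hn
      rw [← hn.2]; exact (log_level (rr_pos hn.1)).1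
    have hUr : ∀ i, ∀ n ∈ U i, (2:ℝ) ^ i ≤ rr (k + 2) A n ∧ (rr (k + 2) A n : ℝ) ≤ 2 * 2 ^ i := by
      intro i n hn
      rw [mem_filter] at hn
      rw [← hn.2]; exact log_level (rr_pos hn.1)
    have hτP : 2 ^ j * ((P j).card : ℝ) ≤ ∑ n ∈ P j, (rr (k + 3) A n : ℝ) := by
      have := card_nsmul_le_sum (P j) (fun n => (rr (k + 3) A n : ℝ)) _ hPr
      rw [nsmul_eq_mul] at this; linarith
    have hsum : ∑ n ∈ P j, (rr (k + 3) A n : ℝ) ≤ ∑ i ∈ range ℓ, 2 * 2 ^ i * IA A (U i) (P j) := by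
      have e1 : ∀ n, (rr (k + 3) A n : ℝ) ≤ ∑ i ∈ range ℓ, 2 * 2 ^ i * (((U i).filter (fun u => n - u ∈ A)).card : ℝ) := by
        intro n
        rw [rr_succ']
        push_cast
        rw [← sum_fiberwise_of_maps_to (g := fun u => Nat.log 2 (rr (k + 2) A u)) (t := range ℓ)]
        · apply sum_le_sum
          intro i _
          rw [← sum_filter]
          have := sum_le_card_nsmul ((U i).filter (fun u => n - u ∈ A)) (fun u => (rr (k + 2) A u : ℝ)) (2 * 2 ^ i)
            (fun u hu => (hUr i u (mem_filter.mp hu).1).2)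
          rw [nsmul_eq_mul] at this
          rw [mul_comm]; exact this
        · intro u _
          rw [mem_range]
          have := Nat.log_mono_right (b := 2) ((rr_le (k + 2) A u).trans hpow)
          omega
      calc _ ≤ ∑ n ∈ P j, ∑ i ∈ range ℓ, 2 * 2 ^ i * (((U i).filter (fun u => n - u ∈ A)).card : ℝ) :=
            sum_le_sum fun n _ => e1 n
        _ = _ := by
            rw [sum_comm]
            apply sum_congr rfl
            intro i _
            rw [IA, mul_sum]
    have hex : ∃ i ∈ range ℓ, 2 ^ j * ((P j).card : ℝ) / L ≤ 2 * 2 ^ i * IA A (U i) (P j) := by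
      apply exists_le_of_sum_le (nonempty_range_iff.mpr (by omega))
      rw [sum_const, card_range, nsmul_eq_mul, ← hL, mul_div_cancel₀ _ (by linarith)]
      exact hτP.trans hsum
    obtain ⟨i, -, hi⟩ := hex
    rw [div_le_iff₀ (by linarith)] at hi
    have hUsub : U i ⊆ SS (k + 2) A := filter_subset _ _
    have hPsub : P j ⊆ SS (k + 3) A := filter_subset _ _
    have hρM : (2:ℝ) ^ i * (U i).card ≤ (A.card : ℝ) ^ (k + 2) := by
      have := card_nsmul_le_sum (U i) (fun n => (rr (k + 2) A n : ℝ)) _ (fun n hn => (hUr i n hn).1)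
      rw [nsmul_eq_mul] at this
      rw [mul_comm, ← hsumr2]
      exact this.trans (sum_le_sum_of_subset_of_nonneg hUsub fun _ _ _ => Nat.cast_nonneg _)
    have hρM2 : ((2:ℝ) ^ i) ^ 2 * (U i).card ≤ En (k + 2) A := by
      have := card_nsmul_le_sum (U i) (fun n => (rr (k + 2) A n : ℝ) ^ 2) (((2:ℝ) ^ i) ^ 2) (fun n hn => by
        have := (hUr i n hn).1
        gcongr)
      rw [nsmul_eq_mul] at this
      rw [mul_comm]
      refine this.trans ?_
      unfold En
      push_cast
      exact sum_le_sum_of_subset_of_nonneg hUsub fun _ _ _ => sq_nonneg _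
    have hinc := incidence m (P j) t ht (h.codeg _) (U i)
    have hlogL : ((Nat.log 2 (U i).card + 1 : ℕ) : ℝ) ≤ L := by
      rw [hL]
      have h1 : (U i).card ≤ A.card ^ (k + 3) := ((card_le_card hUsub).trans (SS_card _ _)).trans hpow
      have := Nat.log_mono_right (b := 2) h1
      exact_mod_cast (by omega : Nat.log 2 (U i).card + 1 ≤ ℓ)
    have hG0 : 0 ≤ Gm (U i).card (P j).card := Gm_nonneg (Nat.cast_nonneg _)
    refine level_real k (P j).card (U i).card A.card (2 ^ i) (2 ^ j) (En (k + 2) A) L (30000 * t * L) t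
      (IA A (U i) (P j)) ?_ ?_ hN1 ?_ ?_ hL1 ?_ ht ?_ ?_ ?_ ?_ hρM hρM2 ?_ ?_
    · exact_mod_cast hPe.card_pos
    · positivity
    · positivity
    · positivity
    · nlinarith
    · positivity
    · refine (IA_le_Inc hA _ _).trans (hinc.trans ?_)
      calc _ ≤ L * (30000 * t * (Gm (U i).card (P j).card + (U i).card + (P j).card)) := by gcongr
        _ = _ := by ring
    · exact IA_le _ _ _
    · linarith
    · refine hτP.trans ?_
      rw [← hsumr]
      exact sum_le_sum_of_subset_of_nonneg hPsub fun _ _ _ => Nat.cast_nonneg _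
    · obtain ⟨n, hn⟩ := hPe
      exact (hPr n hn).trans (rr_bound ht h hA k n)
  have hEn : (En (k + 3) A : ℝ) ≤ ∑ j ∈ range ℓ, 4 * B := by
    unfold En
    push_cast
    rw [← sum_fiberwise_of_maps_to (g := fun u => Nat.log 2 (rr (k + 3) A u)) (t := range ℓ)]
    · apply sum_le_sum
      intro j _
      have := sum_le_card_nsmul (P j) (fun u => (rr (k + 3) A u : ℝ) ^ 2) (4 * (2 ^ j) ^ 2)
        (fun u hu => by
          rw [mem_filter] at hu
          have h1 := (log_level (rr_pos hu.1)).2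
          rw [hu.2] at h1
          calc (rr (k + 3) A u : ℝ) ^ 2 ≤ (2 * 2 ^ j) ^ 2 := by gcongr
            _ = _ := by ring)
      rw [nsmul_eq_mul] at this
      refine this.trans ?_
      have := hlev j
      linarith
    · intro u _
      rw [mem_range]
      have := Nat.log_mono_right (b := 2) (rr_le (k + 3) A u)
      omega
  rw [sum_const, card_range, nsmul_eq_mul, ← hL] at hEn
  exact hEn

theorem onS_card {m : ℕ} (hm : 0 < m) {A : Finset V3} (hA : onS m A) : A.card ≤ 27 * m ^ 3 := by
  have h1 : A ⊆ Fintype.piFinset (fun _ : Fin 3 => Finset.Icc (-(m : ℤ)) m) := by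
    intro a ha
    rw [Fintype.mem_piFinset]
    intro i
    have h2 := hA a ha
    have h3 := single_le_sum (f := fun i => a i ^ 2) (fun i _ => sq_nonneg (a i)) (mem_univ i)
    rw [h2] at h3
    rw [mem_Icc]
    constructor <;> nlinarith
  have h2 := card_le_card h1
  simp only [Fintype.card_piFinset, Int.card_Icc, prod_const, card_univ, Fintype.card_fin] at h2
  have h3 : ((m : ℤ) + 1 - -(m : ℤ)).toNat ≤ 3 * m := by omega
  calc A.card ≤ _ := h2
    _ ≤ (3 * m) ^ 3 := Nat.pow_le_pow_left h3 3
    _ = _ := by ring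

theorem log_bound (s : ℕ) (ε : ℝ) (hε : 0 < ε) : ∃ C : ℝ, 1 ≤ C ∧ ∀ m : ℕ, 0 < m → ∀ A : Finset V3,
    onS m A → A.Nonempty → ((Nat.log 2 (A.card ^ s) + 1 : ℕ) : ℝ) ≤ C * (m : ℝ) ^ ε := by
  have hl27 : 0 ≤ Real.log 27 := Real.log_nonneg (by norm_num)
  refine ⟨1 + 2 * s * (Real.log 27 + 3 / ε), ?_, ?_⟩
  · have : 0 ≤ 2 * s * (Real.log 27 + 3 / ε) := by positivity
    linarith
  · intro m hm A hA hne
    set l := Nat.log 2 (A.card ^ s) with hl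
    have hcard : 0 < A.card := hne.card_pos
    have hm1 : (1 : ℝ) ≤ m := by exact_mod_cast hm
    have h1 : 2 ^ l ≤ A.card ^ s := Nat.pow_log_le_self 2 (by positivity)
    have h2 : A.card ^ s ≤ (27 * m ^ 3) ^ s := Nat.pow_le_pow_left (onS_card hm hA) s
    have h3 : (2 : ℝ) ^ l ≤ (27 * (m : ℝ) ^ 3) ^ s := by exact_mod_cast h1.trans h2
    have h4 := Real.log_le_log (by positivity) h3
    rw [Real.log_pow, Real.log_pow, Real.log_mul (by norm_num) (by positivity), Real.log_pow] at h4
    have h5 : Real.log m ≤ (m : ℝ) ^ ε / ε := Real.log_le_rpow_div (by positivity) hε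
    have h6 : (1 : ℝ) ≤ (m : ℝ) ^ ε := Real.one_le_rpow hm1 hε.le
    have h7 : (1 / 2 : ℝ) ≤ Real.log 2 := by have := Real.log_two_gt_d9; linarith
    have h8 : (l : ℝ) * (1 / 2) ≤ s * (Real.log 27 + 3 * ((m : ℝ) ^ ε / ε)) := by
      calc (l : ℝ) * (1 / 2) ≤ l * Real.log 2 := by gcongr
        _ ≤ _ := h4
        _ ≤ _ := by
            push_cast
            gcongr
    have h9 : (s : ℝ) * (Real.log 27 + 3 * ((m : ℝ) ^ ε / ε)) ≤ s * ((Real.log 27 + 3 / ε) * (m : ℝ) ^ ε) := by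
      gcongr
      have : Real.log 27 ≤ Real.log 27 * (m : ℝ) ^ ε := by nlinarith
      calc _ ≤ Real.log 27 * (m : ℝ) ^ ε + 3 * ((m : ℝ) ^ ε / ε) := by linarith
        _ = _ := by ring
    push_cast
    nlinarith

/-- the exponent -/
def ee (s : ℕ) : ℝ := 2 * (s : ℝ) - 3 + 1 / 2 + (1 / 2) * (3 : ℝ) ^ (-(s : ℝ) + 2)

theorem ee_two : ee 2 = 2 := by
  unfold ee
  norm_num

theorem ee_facts (k : ℕ) : ee (k + 2) + (4 * k + 9 : ℕ) = 3 * ee (k + 3) ∧ ((2 * k + 3 : ℕ) : ℝ) ≤ ee (k + 3) ∧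
    1 + ee (k + 2) ≤ ee (k + 3) := by
  have h1 : (3 : ℝ) ^ (-((k + 2 : ℕ) : ℝ) + 2) = 3 * (3 : ℝ) ^ (-((k + 3 : ℕ) : ℝ) + 2) := by
    have : -((k + 2 : ℕ) : ℝ) + 2 = 1 + (-((k + 3 : ℕ) : ℝ) + 2) := by push_cast; ring
    rw [this, Real.rpow_add (by norm_num), Real.rpow_one]
  have h2 : (0 : ℝ) < (3 : ℝ) ^ (-((k + 3 : ℕ) : ℝ) + 2) := by positivity
  have h3 : (3 : ℝ) ^ (-((k + 2 : ℕ) : ℝ) + 2) ≤ 1 := by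
    apply Real.rpow_le_one_of_one_le_of_nonpos (by norm_num)
    push_cast
    have : (0:ℝ) ≤ k := Nat.cast_nonneg k
    linarith
  unfold ee
  rw [h1] at h3 ⊢
  push_cast at *
  refine ⟨by ring, by linarith, by linarith⟩

theorem energy_bound (k : ℕ) : ∀ ε : ℝ, 0 < ε → ∃ C : ℝ, 1 ≤ C ∧ ∀ m : ℕ, 0 < m → ∀ A : Finset V3,
    onS m A → A.Nonempty → (En (k + 2) A : ℝ) ≤ C * (m : ℝ) ^ ε * (A.card : ℝ) ^ ee (k + 2) := by
  induction k with
  | zero =>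
    intro ε hε
    obtain ⟨C, hC, h⟩ := circle_count ε hε
    refine ⟨2 * C, by linarith, ?_⟩
    intro m hm A hA hne
    have hm1 : (1 : ℝ) ≤ m := by exact_mod_cast hm
    have h6 : (1 : ℝ) ≤ (m : ℝ) ^ ε := Real.one_le_rpow hm1 hε.le
    have := En_two (t := C * (m : ℝ) ^ ε) (by nlinarith) (h m hm) hA
    rw [zero_add, ee_two, Real.rpow_two]
    calc _ ≤ _ := this
      _ = _ := by ring
  | succ k ih =>
    intro ε hε
    set δ := ε / 9 with hδ
    have hδ0 : 0 < δ := by positivity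
    obtain ⟨C1, hC1, h1⟩ := circle_count δ hδ0
    obtain ⟨C2, hC2, h2⟩ := log_bound (k + 3) δ hδ0
    obtain ⟨C3, hC3, h3⟩ := ih δ hδ0
    refine ⟨C2 * (4 * (2 * C1 * (6 * C2 * (30000 * C1 * C2)) ^ 2 * (3 * C3))), ?_, ?_⟩
    · have hp : 1 ≤ 6 * C2 * (30000 * C1 * C2) := by
        have : 1 ≤ C1 * C2 := one_le_mul_of_one_le_of_one_le hC1 hC2
        nlinarith
      have hp2 : 1 ≤ (6 * C2 * (30000 * C1 * C2)) ^ 2 := one_le_pow₀ hp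
      have hp3 : 1 ≤ 2 * C1 * (6 * C2 * (30000 * C1 * C2)) ^ 2 :=
        one_le_mul_of_one_le_of_one_le (by linarith) hp2
      have hp4 : 1 ≤ 2 * C1 * (6 * C2 * (30000 * C1 * C2)) ^ 2 * (3 * C3) :=
        one_le_mul_of_one_le_of_one_le hp3 (by linarith)
      exact one_le_mul_of_one_le_of_one_le hC2 (by linarith)
    intro m hm A hA hne
    have hm1 : (1 : ℝ) ≤ m := by exact_mod_cast hm
    set y := (m : ℝ) ^ δ with hy
    have hy1 : 1 ≤ y := Real.one_le_rpow hm1 hδ0.le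
    have hy9 : y ^ 9 = (m : ℝ) ^ ε := by
      rw [hy, ← Real.rpow_natCast, ← Real.rpow_mul (by positivity), hδ]
      congr 1
      push_cast
      ring
    have hC1y : 1 ≤ C1 * y := one_le_mul_of_one_le_of_one_le hC1 hy1
    have hC3y : 1 ≤ C3 * y := one_le_mul_of_one_le_of_one_le hC3 hy1
    have hstep := energy_step k m (C1 * y) hC1y (h1 m hm) A hA hne _ rfl
    have hL := h2 m hm A hA hne
    have hE := h3 m hm A hA hne
    set L : ℝ := ((Nat.log 2 (A.card ^ (k + 3)) + 1 : ℕ) : ℝ) with hLdef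
    have hL0 : 0 ≤ L := by positivity
    set N : ℝ := ((A.card : ℕ) : ℝ) with hN
    have hN1 : 1 ≤ N := by rw [hN]; exact_mod_cast hne.card_pos
    have hN0 : 0 < N := by linarith
    obtain ⟨f1, f2, f3⟩ := ee_facts k
    have hterm1 : ((En (k + 2) A : ℝ) * N ^ (4 * k + 9)) ^ ((1 : ℝ) / 3) ≤ C3 * y * N ^ ee (k + 3) := by
      calc ((En (k + 2) A : ℝ) * N ^ (4 * k + 9)) ^ ((1 : ℝ) / 3)
          ≤ (C3 * y * N ^ ee (k + 2) * N ^ (4 * k + 9)) ^ ((1 : ℝ) / 3) := by gcongr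
        _ = (C3 * y * N ^ (3 * ee (k + 3))) ^ ((1 : ℝ) / 3) := by
            rw [← f1, Real.rpow_add hN0, Real.rpow_natCast, mul_assoc (C3 * y)]
        _ = (C3 * y) ^ ((1 : ℝ) / 3) * N ^ ee (k + 3) := by
            rw [Real.mul_rpow (by positivity) (by positivity), ← Real.rpow_mul hN0.le]
            congr 2
            ring
        _ ≤ C3 * y * N ^ ee (k + 3) := by
            gcongr
            calc (C3 * y) ^ ((1 : ℝ) / 3) ≤ (C3 * y) ^ (1 : ℝ) :=
                  Real.rpow_le_rpow_of_exponent_le hC3y (by norm_num)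
              _ = _ := Real.rpow_one _
    have hNe0 : 0 ≤ N ^ ee (k + 3) := by positivity
    have hterm2 : N ^ (2 * k + 3) ≤ C3 * y * N ^ ee (k + 3) := by
      have : N ^ (2 * k + 3) ≤ N ^ ee (k + 3) := by
        rw [← Real.rpow_natCast]
        exact Real.rpow_le_rpow_of_exponent_le hN1 f2
      nlinarith
    have hterm3 : N * En (k + 2) A ≤ C3 * y * N ^ ee (k + 3) := by
      calc N * En (k + 2) A ≤ N * (C3 * y * N ^ ee (k + 2)) := by gcongr
        _ = C3 * y * N ^ (1 + ee (k + 2)) := by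
            rw [Real.rpow_add hN0, Real.rpow_one]; ring
        _ ≤ _ := by
            gcongr
    have hsum : ((En (k + 2) A : ℝ) * N ^ (4 * k + 9)) ^ ((1 : ℝ) / 3) + N ^ (2 * k + 3) + N * En (k + 2) A
        ≤ 3 * (C3 * y * N ^ ee (k + 3)) := by linarith
    calc (En (k + 1 + 2) A : ℝ) ≤ _ := hstep
      _ ≤ (C2 * y) * (4 * (2 * (C1 * y) * (6 * (C2 * y) * (30000 * (C1 * y) * (C2 * y))) ^ 2 *
          (3 * (C3 * y * N ^ ee (k + 3))))) := by gcongr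
      _ = C2 * (4 * (2 * C1 * (6 * C2 * (30000 * C1 * C2)) ^ 2 * (3 * C3))) * y ^ 9 * N ^ ee (k + 3) := by ring
      _ = _ := by rw [hy9]

theorem statement_2 (s : ℕ) (hs : 2 ≤ s) (ε : ℝ) (hε : 0 < ε) :
    ∃ C : ℝ, 0 < C ∧
      ∀ m : ℕ, 0 < m → ∀ A : Set (Fin 3 → ℤ), A.Finite → A.Nonempty → A ⊆ latSphere 3 m →
        (addEnergy s A : ℝ) ≤ C * (m : ℝ) ^ ε *
          (A.ncard : ℝ) ^
            (2 * (s : ℝ) - 3 + 1 / 2 + (1 / 2) * (3 : ℝ) ^ (-(s : ℝ) + 2)) := by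
  obtain ⟨k, rfl⟩ : ∃ k, s = k + 2 := ⟨s - 2, by omega⟩
  obtain ⟨C, hC, h⟩ := energy_bound k ε hε
  refine ⟨C, by linarith, ?_⟩
  intro m hm A hfin hne hA
  lift A to Finset V3 using hfin
  have := h m hm A (fun a ha => hA ha) (by simpa using hne)
  rw [← addEnergy_eq] at this
  rw [Set.ncard_coe_finset]
  exact this
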